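/- There exists a bounded linear operator T on a complex separable infinite-dimensional Hilbert space H having the following three properties: (P1) for every vector x ∈ H, the closure of the orbit Orb(x,T) = {T^n x : n ≥ 0} is a linear subspace, i.e. the closures of {T^n x : n ≥ 0} and of its linear span coincide; (P2) the family of all orbit closures (cl(Orb(x,T)))_{x ∈ H} is totally ordered by inclusion: for every pair (x,y) of vectors of H, either cl(Orb(x,T)) ⊆ cl(Orb(y,T)) or cl(Orb(y,T)) ⊆ cl(Orb(x,T)); (P') for every closed subspace M of H invariant under T, there exists a vector x ∈ M with cl(Orb(x,T)) = M. -/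

import Mathlib

namespace RT

section partB
open Finset
variable {H : Type} [NormedAddCommGroup H] [InnerProductSpace ℂ H]

noncomputable def opOn (e : ℕ → H) (s : Finset ℕ) (u : ℕ → H) : H →L[ℂ] H :=
  ∑ j ∈ s, (innerSL ℂ (e j)).smulRight (u j)

lemma opOn_apply (e : ℕ → H) (s : Finset ℕ) (u : ℕ → H) (x : H) :
    opOn e s u x = ∑ j ∈ s, inner ℂ (e j) x • u j := by
  simp [opOn]

lemma opOn_e {e : ℕ → H} (he : Orthonormal ℂ e) (s : Finset ℕ) (u : ℕ → H) (i : ℕ) :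
    opOn e s u (e i) = if i ∈ s then u i else 0 := by
  rw [opOn_apply]
  simp only [orthonormal_iff_ite.mp he, ite_smul, one_smul, zero_smul, Finset.sum_ite_eq']

lemma ext_e {e : ℕ → H} (hd : (Submodule.span ℂ (Set.range e)).topologicalClosure = ⊤)
    {A B : H →L[ℂ] H} (h : ∀ j, A (e j) = B (e j)) : A = B := by
  apply ContinuousLinearMap.ext_on (s := Set.range e)
  · rw [dense_iff_closure_eq, ← Submodule.topologicalClosure_coe, hd]; rfl
  · rintro _ ⟨j, rfl⟩; exact h j

lemma norm_sum_sq {e : ℕ → H} (he : Orthonormal ℂ e) (s : Finset ℕ) (a : ℕ → ℂ) (σ : ℕ → ℕ)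
    (hσ : Set.InjOn σ s) : ‖∑ j ∈ s, a j • e (σ j)‖ ^ 2 = ∑ j ∈ s, ‖a j‖ ^ 2 := by
  have h := he.comp (fun j : s => σ j) (by
    intro i j hij; exact Subtype.ext (hσ i.2 j.2 hij))
  have h2 := h.inner_sum (fun j => a j) (fun j => a j) Finset.univ
  rw [Finset.univ_eq_attach, Finset.sum_attach s (fun j => (starRingEnd ℂ) (a j) * a j)] at h2
  simp only [Function.comp] at h2
  rw [Finset.sum_attach s (fun j => a j • e (σ j)), inner_self_eq_norm_sq_to_K] at h2
  have : ∀ j, (starRingEnd ℂ) (a j) * a j = ((‖a j‖ ^ 2 : ℝ) : ℂ) := by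
    intro j; rw [mul_comm, Complex.mul_conj, Complex.normSq_eq_norm_sq]
  simp only [this] at h2
  exact Complex.ofReal_injective (by simpa using h2)

lemma opOn_norm_shift {e : ℕ → H} (he : Orthonormal ℂ e) (s : Finset ℕ) (l : ℕ → ℂ) (σ : ℕ → ℕ)
    (hσ : Set.InjOn σ s) {L : ℝ} (hL : 0 ≤ L) (hl : ∀ j ∈ s, ‖l j‖ ≤ L) :
    ‖opOn e s (fun j => l j • e (σ j))‖ ≤ L := by
  refine ContinuousLinearMap.opNorm_le_bound _ hL fun x => ?_
  refine le_of_sq_le_sq ?_ (by positivity)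
  rw [opOn_apply]
  simp only [smul_smul]
  rw [norm_sum_sq he s _ σ hσ, mul_pow]
  calc _ ≤ ∑ j ∈ s, L ^ 2 * ‖inner ℂ (e j) x‖ ^ 2 := by
        refine Finset.sum_le_sum fun j hj => ?_
        rw [norm_mul, mul_pow, mul_comm]
        have := hl j hj
        gcongr
    _ ≤ _ := by
        rw [← Finset.mul_sum]
        gcongr
        exact he.sum_inner_products_le x

lemma norm_inner_e {e : ℕ → H} (he : Orthonormal ℂ e) (j : ℕ) (x : H) :
    ‖inner ℂ (e j) x‖ ≤ ‖x‖ := by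
  simpa [he.1 j] using norm_inner_le_norm (𝕜 := ℂ) (e j) x

lemma opOn_norm_sum {e : ℕ → H} (he : Orthonormal ℂ e) (s : Finset ℕ) (u : ℕ → H) :
    ‖opOn e s u‖ ≤ ∑ j ∈ s, ‖u j‖ := by
  refine ContinuousLinearMap.opNorm_le_bound _ (by positivity) fun x => ?_
  rw [opOn_apply, Finset.sum_mul]
  refine (norm_sum_le _ _).trans (Finset.sum_le_sum fun j _ => ?_)
  rw [norm_smul, mul_comm]
  gcongr
  exact norm_inner_e he j x

noncomputable def Pr (e : ℕ → H) (k : ℕ) : H →L[ℂ] H := opOn e (range k) e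

lemma Pr_apply (e : ℕ → H) (k : ℕ) (x : H) :
    Pr e k x = ∑ j ∈ range k, inner ℂ (e j) x • e j := opOn_apply _ _ _ _

lemma Pr_e {e : ℕ → H} (he : Orthonormal ℂ e) (k i : ℕ) :
    Pr e k (e i) = if i < k then e i else 0 := by
  rw [Pr, opOn_e he]; simp

lemma inner_Pr {e : ℕ → H} (he : Orthonormal ℂ e) (k i : ℕ) (x : H) :
    inner ℂ (e i) (Pr e k x) = if i < k then inner ℂ (e i) x else 0 := by
  rw [Pr_apply, inner_sum]
  simp [inner_smul_right, orthonormal_iff_ite.mp he]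

lemma pyth {e : ℕ → H} (he : Orthonormal ℂ e) (k : ℕ) (x : H) :
    ‖x‖ ^ 2 = ‖Pr e k x‖ ^ 2 + ‖x - Pr e k x‖ ^ 2 := by
  have h : inner ℂ (Pr e k x) (x - Pr e k x) = 0 := by
    conv_lhs => rw [Pr_apply e k x]
    rw [sum_inner]
    refine Finset.sum_eq_zero fun j hj => ?_
    rw [inner_smul_left, inner_sub_right, ← Pr_apply, inner_Pr he]
    simp [Finset.mem_range.mp hj]
  have := norm_add_sq_eq_norm_sq_add_norm_sq_of_inner_eq_zero _ _ h
  rw [add_sub_cancel] at this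
  simpa [sq] using this

lemma Pr_norm_le {e : ℕ → H} (he : Orthonormal ℂ e) (k : ℕ) (x : H) : ‖Pr e k x‖ ≤ ‖x‖ := by
  refine le_of_sq_le_sq ?_ (norm_nonneg _)
  rw [pyth he k x]; nlinarith [sq_nonneg ‖x - Pr e k x‖]

lemma Pr_compl_norm_le {e : ℕ → H} (he : Orthonormal ℂ e) (k : ℕ) (x : H) :
    ‖x - Pr e k x‖ ≤ ‖x‖ := by
  refine le_of_sq_le_sq ?_ (norm_nonneg _)
  rw [pyth he k x]; nlinarith [sq_nonneg ‖Pr e k x‖]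

/-- x only involves e_i for i<k -/
def Supp (e : ℕ → H) (k : ℕ) (x : H) : Prop := ∀ i, k ≤ i → inner ℂ (e i) x = 0
def Tail (e : ℕ → H) (k : ℕ) (x : H) : Prop := ∀ i, i < k → inner ℂ (e i) x = 0

lemma eq_zero_of_inner {e : ℕ → H} 
    (hd : (Submodule.span ℂ (Set.range e)).topologicalClosure = ⊤) {x : H}
    (h : ∀ i, inner ℂ (e i) x = 0) : x = 0 := by
  have h2 : innerSL ℂ x = 0 := by
    apply ContinuousLinearMap.ext_on (s := Set.range e)
    · rw [dense_iff_closure_eq, ← Submodule.topologicalClosure_coe, hd]; rfl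
    · rintro _ ⟨j, rfl⟩
      simp [← inner_conj_symm x (e j), h j]
  have := congrArg (fun f => f x) h2
  simpa using this

lemma Supp.eq {e : ℕ → H} (he : Orthonormal ℂ e)
    (hd : (Submodule.span ℂ (Set.range e)).topologicalClosure = ⊤) {k : ℕ} {x : H}
    (h : Supp e k x) : Pr e k x = x := by
  rw [← sub_eq_zero]
  apply eq_zero_of_inner hd
  intro i
  rw [inner_sub_right, inner_Pr he]
  split_ifs with hi
  · simp
  · simp [h i (not_lt.mp hi)]

lemma supp_Pr {e : ℕ → H} (he : Orthonormal ℂ e) (k : ℕ) (x : H) : Supp e k (Pr e k x) := by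
  intro i hi; rw [inner_Pr he, if_neg (not_lt.mpr hi)]

lemma tail_compl {e : ℕ → H} (he : Orthonormal ℂ e) (k : ℕ) (x : H) :
    Tail e k (x - Pr e k x) := by
  intro i hi; rw [inner_sub_right, inner_Pr he, if_pos hi, sub_self]

lemma Supp.mono {e : ℕ → H} {k l : ℕ} {x : H} (h : Supp e k x) (hkl : k ≤ l) : Supp e l x :=
  fun i hi => h i (hkl.trans hi)
lemma Supp.add {e : ℕ → H} {k : ℕ} {x y : H} (h : Supp e k x) (h' : Supp e k y) :
    Supp e k (x + y) := fun i hi => by rw [inner_add_right, h i hi, h' i hi, add_zero]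
lemma Supp.sub {e : ℕ → H} {k : ℕ} {x y : H} (h : Supp e k x) (h' : Supp e k y) :
    Supp e k (x - y) := fun i hi => by rw [inner_sub_right, h i hi, h' i hi, sub_zero]
lemma Supp.smul {e : ℕ → H} {k : ℕ} {x : H} (h : Supp e k x) (a : ℂ) :
    Supp e k (a • x) := fun i hi => by rw [inner_smul_right, h i hi, mul_zero]
lemma supp_zero {e : ℕ → H} {k : ℕ} : Supp e k (0 : H) := fun i _ => inner_zero_right _
lemma supp_sum {e : ℕ → H} {k : ℕ} (s : Finset ℕ) (f : ℕ → H) (h : ∀ i ∈ s, Supp e k (f i)) :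
    Supp e k (∑ i ∈ s, f i) := fun i hi => by
  rw [inner_sum]; exact Finset.sum_eq_zero fun j hj => h j hj i hi
lemma supp_e {e : ℕ → H} (he : Orthonormal ℂ e) {j k : ℕ} (h : j < k) : Supp e k (e j) :=
  fun i hi => he.2 (by omega)

lemma supp_map {e : ℕ → H} (he : Orthonormal ℂ e)
    (hd : (Submodule.span ℂ (Set.range e)).topologicalClosure = ⊤) {k l : ℕ} {x : H}
    (h : Supp e k x) (A : H →L[ℂ] H) (hA : ∀ j < k, Supp e l (A (e j))) : Supp e l (A x) := by
  rw [← h.eq he hd, Pr_apply, map_sum]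
  refine supp_sum _ _ fun i hi => ?_
  rw [map_smul]
  exact (hA i (Finset.mem_range.mp hi)).smul _

lemma map_congr {e : ℕ → H} (he : Orthonormal ℂ e)
    (hd : (Submodule.span ℂ (Set.range e)).topologicalClosure = ⊤) {k : ℕ} {x : H}
    (h : Supp e k x) (A B : H →L[ℂ] H) (hA : ∀ j < k, A (e j) = B (e j)) : A x = B x := by
  rw [← h.eq he hd, Pr_apply, map_sum, map_sum]
  refine Finset.sum_congr rfl fun i hi => ?_
  rw [map_smul, map_smul, hA i (Finset.mem_range.mp hi)]

lemma map_bound {e : ℕ → H} (he : Orthonormal ℂ e)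
    (hd : (Submodule.span ℂ (Set.range e)).topologicalClosure = ⊤) {k : ℕ} {x : H}
    (h : Supp e k x) (A : H →L[ℂ] H) {ε : ℝ} (hA : ∀ j < k, ‖A (e j)‖ ≤ ε) :
    ‖A x‖ ≤ k * ε * ‖x‖ := by
  rw [← h.eq he hd, Pr_apply, map_sum]
  rw [← Pr_apply, h.eq he hd]
  calc _ ≤ ∑ i ∈ range k, ε * ‖x‖ := by
        refine (norm_sum_le _ _).trans (Finset.sum_le_sum fun i hi => ?_)
        rw [map_smul, norm_smul, mul_comm]
        have h1 := hA i (Finset.mem_range.mp hi)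
        have h2 := norm_inner_e he i x
        have h3 := norm_nonneg (A (e i))
        gcongr
        linarith
    _ = _ := by simp; ring

lemma Pr_tendsto {e : ℕ → H} (he : Orthonormal ℂ e)
    (hd : (Submodule.span ℂ (Set.range e)).topologicalClosure = ⊤) (x : H) :
    Filter.Tendsto (fun k => Pr e k x) Filter.atTop (nhds x) := by
  rw [Metric.tendsto_atTop]
  intro ε hε
  have hx : x ∈ closure (Submodule.span ℂ (Set.range e) : Set H) := by
    rw [← Submodule.topologicalClosure_coe, hd]; trivial
  obtain ⟨y, hy, hxy⟩ := Metric.mem_closure_iff.mp hx ε hε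
  have : ∃ k, Supp e k y := by
    refine Submodule.span_induction (p := fun y _ => ∃ k, Supp e k y) ?_ ?_ ?_ ?_ hy
    · rintro _ ⟨j, rfl⟩; exact ⟨j + 1, supp_e he (Nat.lt_succ_self j)⟩
    · exact ⟨0, supp_zero⟩
    · rintro a b _ _ ⟨k, hk⟩ ⟨l, hl⟩
      exact ⟨max k l, (hk.mono (le_max_left _ _)).add (hl.mono (le_max_right _ _))⟩
    · rintro a b _ ⟨k, hk⟩; exact ⟨k, hk.smul a⟩
  obtain ⟨k, hk⟩ := this
  refine ⟨k, fun n hn => ?_⟩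
  have h1 := (hk.mono hn).eq he hd
  have h2 := Pr_compl_norm_le he n (x - y)
  rw [map_sub, h1] at h2
  rw [dist_comm, dist_eq_norm]
  rw [dist_eq_norm] at hxy
  have : x - y - (Pr e n x - y) = x - Pr e n x := by abel
  rw [this] at h2
  linarith

lemma pow_diff (X Y : H →L[ℂ] H) {L : ℝ} (hL : 1 ≤ L) (hX : ‖X‖ ≤ L) (hY : ‖Y‖ ≤ L) (a : ℕ) :
    ‖X ^ a - Y ^ a‖ ≤ a * L ^ a * ‖X - Y‖ := by
  induction a with
  | zero => simp
  | succ a ih =>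
    have h1 : X ^ (a+1) - Y ^ (a+1) = X * (X ^ a - Y ^ a) + (X - Y) * Y ^ a := by
      rw [pow_succ', pow_succ']; noncomm_ring
    have hYa : ‖Y ^ a‖ ≤ L ^ a := by
      have : ‖Y ^ a‖ ≤ ‖Y‖ ^ a := by
        rcases Nat.eq_zero_or_pos a with rfl | ha
        · rw [pow_zero, pow_zero]; exact ContinuousLinearMap.norm_id_le
        · exact norm_pow_le' Y ha
      exact this.trans (by gcongr)
    rw [h1]
    have hLa : L ^ a ≤ L ^ (a+1) := pow_le_pow_right₀ hL (Nat.le_succ a)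
    calc _ ≤ ‖X‖ * ‖X ^ a - Y ^ a‖ + ‖X - Y‖ * ‖Y ^ a‖ :=
          (norm_add_le _ _).trans (add_le_add (norm_mul_le _ _) (norm_mul_le _ _))
      _ ≤ L * (a * L ^ a * ‖X - Y‖) + ‖X - Y‖ * L ^ (a+1) := by
          gcongr
          exact hYa.trans hLa
      _ = _ := by push_cast; ring
end partB

section partC
open Finset
variable {H : Type} [NormedAddCommGroup H] [InnerProductSpace ℂ H]
structure Good (e : ℕ → H) (N : ℕ) (A : H →L[ℂ] H) (cons : List (ℕ × ℕ)) : Prop where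
  zero : ∀ j, N < j → A (e j) = 0
  supp : ∀ j, Supp e (j + 2) (A (e j))
  suppN : ∀ x, Supp e (N + 1) (A x)
  last : A (e N) = 0
  top : ∃ lam : ℂ, lam ≠ 0 ∧ (A ^ N) (e 0) = lam • e N
  cyc : ∀ j ≤ N, e j ∈ Submodule.span ℂ ((fun i => (A ^ i) (e 0)) '' Set.Iic N)
  cons : ∀ p ∈ cons, 1 ≤ p.1 ∧ p.2 ≤ N + 1 ∧ ∃ C : ℝ, 0 ≤ C ∧ C < 7 ∧
    ∀ x, Tail e p.2 x → ‖(A ^ p.1) x‖ ≤ C * ‖x‖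

structure VS (e : ℕ → H) (N : ℕ) (A : H →L[ℂ] H) (lam b : ℂ) (c h : ℕ) (K μ : ℕ → ℂ)
    (v : ℕ → H) (A' : H →L[ℂ] H) : Prop where
  head : ∀ j ≤ N, v j = (A ^ j) (e 0)
  gap : ∀ r s, N < s → s < c → r * c + s ≤ h * c + N + 1 →
    v (r * c + s) = (K s)⁻¹ • e (r * c + s)
  fan : ∀ r s, r < h → s ≤ N → v ((r + 1) * c + s) =
    (1/2 : ℂ) • v (r * c + s) + b • v (r * c + s + 1) + (μ s)⁻¹ • e ((r + 1) * c + s)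
  zero : ∀ j, h * c + N + 1 < j → v j = 0
  a1 : ∀ j < N, A' (e j) = A (e j)
  a2 : A' (e N) = lam⁻¹ • v (N + 1)
  a3 : ∀ r s, N < s → s < c → r * c + s ≤ h * c + N + 1 →
    A' (e (r * c + s)) = K s • v (r * c + s + 1)
  a4 : ∀ r s, r < h → s ≤ N → A' (e ((r + 1) * c + s)) =
    μ s • (v ((r + 1) * c + s + 1) - (1/2 : ℂ) • v (r * c + s + 1) - b • v (r * c + s + 2))
  a5 : ∀ j, h * c + N + 1 < j → A' (e j) = 0

lemma exists_VS {e : ℕ → H} (he : Orthonormal ℂ e) (N : ℕ) (A : H →L[ℂ] H) (lam b : ℂ)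
    (c h : ℕ) (hc : N + 3 < c) (hh : 1 ≤ h) (K μ : ℕ → ℂ) :
    ∃ v A', VS e N A lam b c h K μ v A' := by
  let V : ℕ → ℕ → H := fun r => Nat.rec
    (fun s => if s ≤ N then (A ^ s) (e 0) else (K s)⁻¹ • e s)
    (fun r f s => if s ≤ N then (1/2 : ℂ) • f s + b • f (s + 1) + (μ s)⁻¹ • e ((r + 1) * c + s)
      else (K s)⁻¹ • e ((r + 1) * c + s)) r
  have V0 : ∀ s, V 0 s = if s ≤ N then (A ^ s) (e 0) else (K s)⁻¹ • e s := fun s => rfl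
  have V1 : ∀ r s, V (r + 1) s = if s ≤ N then (1/2 : ℂ) • V r s + b • V r (s + 1) +
      (μ s)⁻¹ • e ((r + 1) * c + s) else (K s)⁻¹ • e ((r + 1) * c + s) := fun r s => rfl
  let v : ℕ → H := fun j => if j ≤ h * c + N + 1 then V (j / c) (j % c) else 0
  have hdiv : ∀ r s, s < c → (r * c + s) / c = r := fun r s hs => by
    rw [mul_comm, Nat.mul_add_div (by omega), Nat.div_eq_of_lt hs, add_zero]
  have hmod : ∀ r s, s < c → (r * c + s) % c = s := fun r s hs => by
    rw [mul_comm, Nat.mul_add_mod, Nat.mod_eq_of_lt hs]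
  have hv : ∀ r s, s < c → r * c + s ≤ h * c + N + 1 → v (r * c + s) = V r s := by
    intro r s hs hj
    simp only [v]
    rw [if_pos hj, hdiv r s hs, hmod r s hs]
  have hrh : ∀ r, r < h → (r + 1) * c ≤ h * c := fun r hr => Nat.mul_le_mul_right c hr
  have hch : c ≤ h * c := Nat.le_mul_of_pos_left c hh
  let u : ℕ → H := fun j => if j < N then A (e j) else if j = N then lam⁻¹ • v (N + 1) else
    if N < j % c then K (j % c) • v (j + 1) else
    μ (j % c) • (v (j + 1) - (1/2 : ℂ) • v (j + 1 - c) - b • v (j + 2 - c))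
  refine ⟨v, opOn e (range (h * c + N + 2)) u, ?_, ?_, ?_, ?_, ?_, ?_, ?_, ?_, ?_⟩
  · intro j hj
    have := hv 0 j (by omega) (by omega)
    rw [zero_mul, zero_add] at this
    rw [this, V0, if_pos hj]
  · intro r s hs hsc hj
    rw [hv r s hsc hj]
    cases r with
    | zero => rw [V0, if_neg (by omega), zero_mul, zero_add]
    | succ r => rw [V1, if_neg (by omega)]
  · intro r s hr hs
    have := hrh r hr
    rw [add_mul, one_mul] at this
    rw [hv (r+1) s (by omega) (by rw [add_mul]; omega), V1, if_pos hs, add_assoc (r * c),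
      hv r s (by omega) (by omega), hv r (s+1) (by omega) (by omega)]
  · intro j hj; simp only [v]; rw [if_neg (by omega)]
  · intro j hj
    rw [opOn_e he, if_pos (by simp; omega)]
    simp only [u]; rw [if_pos hj]
  · rw [opOn_e he, if_pos (by simp; omega)]
    simp [u]
  · intro r s hs hsc hj
    have : s ≤ r * c + s := Nat.le_add_left _ _
    rw [opOn_e he, if_pos (by simp; omega)]
    simp only [u]; rw [if_neg (by omega), if_neg (by omega), hmod r s hsc, if_pos hs]
  · intro r s hr hs
    have := hrh r hr
    have h2 : (r + 1) * c = r * c + c := by ring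
    rw [opOn_e he, if_pos (by simp; omega)]
    simp only [u]; rw [if_neg (by omega), if_neg (by omega), hmod (r+1) s (by omega),
      if_neg (by omega)]
    congr 5 <;> omega
  · intro j hj
    rw [opOn_e he, if_neg (by simp; omega)]

/-- case split of an index -/
lemma idx (N c h : ℕ) (hc : N + 3 < c) (j : ℕ) :
    j < N ∨ j = N ∨ h * c + N + 1 < j ∨
    (∃ r s, j = (r + 1) * c + s ∧ r < h ∧ s ≤ N) ∨
    (∃ r s, j = r * c + s ∧ N < s ∧ s < c ∧ r < h) ∨ j = h * c + (N + 1) := by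
  by_cases h1 : j ≤ N
  · omega
  by_cases h2 : h * c + N + 1 < j
  · omega
  have hm : j % c < c := Nat.mod_lt _ (by omega)
  have hj : j = j / c * c + j % c := by rw [mul_comm]; exact (Nat.div_add_mod j c).symm
  generalize j / c = r at hj
  generalize j % c = s at hj hm
  have hr : r ≤ h := by
    by_contra hcon
    have : (h + 1) * c ≤ r * c := Nat.mul_le_mul_right c (by omega)
    rw [add_mul] at this
    omega
  by_cases hs : s ≤ N
  · cases r with
    | zero => omega
    | succ r => exact Or.inr (Or.inr (Or.inr (Or.inl ⟨r, s, hj, hr, hs⟩)))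
  · rcases hr.lt_or_eq with h3 | rfl
    · exact Or.inr (Or.inr (Or.inr (Or.inr (Or.inl ⟨r, s, hj, by omega, hm, h3⟩))))
    · right; right; right; right; right; omega

variable {e : ℕ → H} {N : ℕ} {A : H →L[ℂ] H} {lam b : ℂ} {c h : ℕ} {K μ : ℕ → ℂ}
    {v : ℕ → H} {A' : H →L[ℂ] H} {cons : List (ℕ × ℕ)}

lemma Good.supp_pow (he : Orthonormal ℂ e)
    (hd : (Submodule.span ℂ (Set.range e)).topologicalClosure = ⊤)
    (g : Good e N A cons) {x : H} {k : ℕ} (hx : Supp e k x) (i : ℕ) :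
    Supp e (k + i) ((A ^ i) x) := by
  induction i with
  | zero => simpa using hx
  | succ i ih =>
    rw [pow_succ']
    refine supp_map he hd ih A fun j hj => (g.supp j).mono (by omega)

lemma VS.step (he : Orthonormal ℂ e)
    (hd : (Submodule.span ℂ (Set.range e)).topologicalClosure = ⊤)
    (g : Good e N A cons) (hc : N + 3 < c) (hlam : lam ≠ 0) (htop : (A ^ N) (e 0) = lam • e N)
    (hK : ∀ s, K s ≠ 0) (hμ : ∀ s, μ s ≠ 0)
    (S : VS e N A lam b c h K μ v A') (j : ℕ) : A' (v j) = v (j + 1) := by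
  induction j using Nat.strong_induction_on with
  | _ j ih =>
  rcases idx N c h hc j with h1 | h1 | h1 | ⟨r, s, rfl, hr, hs⟩ | ⟨r, s, rfl, hs, hsc, hr⟩ | h1
  · rw [S.head j h1.le, S.head (j+1) h1, pow_succ' A j]
    have := g.supp_pow he hd (supp_e he (Nat.zero_lt_one)) j
    exact map_congr he hd this _ _ fun i hi => S.a1 i (by omega)
  · subst h1
    rw [S.head j le_rfl, htop, map_smul, S.a2, smul_smul, mul_inv_cancel₀ hlam, one_smul]
  · rw [S.zero j h1, S.zero (j+1) (by omega), map_zero]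
  · have h2 : (r + 1) * c = r * c + c := by ring
    rw [S.fan r s hr hs, map_add, map_add, map_smul, map_smul, map_smul, S.a4 r s hr hs,
      smul_smul, inv_mul_cancel₀ (hμ s), one_smul, ih (r * c + s) (by omega),
      ih (r * c + s + 1) (by omega)]
    abel
  · have h2 : (r + 1) * c ≤ h * c := Nat.mul_le_mul_right c hr
    rw [add_mul] at h2
    rw [S.gap r s hs hsc (by omega), map_smul, S.a3 r s hs hsc (by omega), smul_smul,
      inv_mul_cancel₀ (hK s), one_smul]
  · subst h1
    rw [S.gap h (N+1) (by omega) (by omega) (by omega), map_smul,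
      S.a3 h (N+1) (by omega) (by omega) (by omega), smul_smul,
      inv_mul_cancel₀ (hK _), one_smul]

lemma pow_step {A' : H →L[ℂ] H} {v : ℕ → H} (hs : ∀ j, A' (v j) = v (j + 1)) (i j : ℕ) :
    (A' ^ i) (v j) = v (j + i) := by
  induction i with
  | zero => simp
  | succ i ih =>
    rw [pow_succ']
    change A' ((A' ^ i) (v j)) = _
    rw [ih, hs]; rfl

lemma VS.suppv (he : Orthonormal ℂ e)
    (hd : (Submodule.span ℂ (Set.range e)).topologicalClosure = ⊤)
    (g : Good e N A cons) (hc : N + 3 < c) 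
    (S : VS e N A lam b c h K μ v A') (j : ℕ) : Supp e (j + 1) (v j) := by
  induction j using Nat.strong_induction_on with
  | _ j ih =>
  have hhead : ∀ j ≤ N, Supp e (j + 1) (v j) := fun j hj => by
    rw [S.head j hj, add_comm]
    exact g.supp_pow he hd (supp_e he (Nat.zero_lt_one)) j
  rcases idx N c h hc j with h1 | h1 | h1 | ⟨r, s, rfl, hr, hs⟩ | ⟨r, s, rfl, hs, hsc, hr⟩ | h1
  · exact hhead j h1.le
  · exact hhead j h1.le
  · rw [S.zero j h1]; exact supp_zero
  · have h2 : (r + 1) * c = r * c + c := by ring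
    rw [S.fan r s hr hs]
    refine Supp.add (Supp.add ?_ ?_) ?_
    · exact ((ih (r * c + s) (by omega)).mono (by omega)).smul _
    · exact ((ih (r * c + s + 1) (by omega)).mono (by omega)).smul _
    · exact (supp_e he (Nat.lt_succ_self _)).smul _
  · have h2 : (r + 1) * c ≤ h * c := Nat.mul_le_mul_right c hr
    rw [add_mul] at h2
    rw [S.gap r s hs hsc (by omega)]
    exact (supp_e he (Nat.lt_succ_self _)).smul _
  · subst h1
    rw [S.gap h (N+1) (by omega) (by omega) (by omega)]
    exact (supp_e he (Nat.lt_succ_self _)).smul _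

lemma VS.suppN (he : Orthonormal ℂ e)
    (hd : (Submodule.span ℂ (Set.range e)).topologicalClosure = ⊤)
    (g : Good e N A cons) (hc : N + 3 < c) 
    (S : VS e N A lam b c h K μ v A') (j : ℕ) : Supp e (h * c + N + 2) (v j) := by
  by_cases hj : h * c + N + 1 < j
  · rw [S.zero j hj]; exact supp_zero
  · exact (S.suppv he hd g hc j).mono (by omega)

lemma VS.efan (hμ : ∀ s, μ s ≠ 0) (S : VS e N A lam b c h K μ v A') (r s : ℕ) (hr : r < h)
    (hs : s ≤ N) : e ((r + 1) * c + s) = μ s • (v ((r+1) * c + s) - (1/2 : ℂ) • v (r * c + s)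
          - b • v (r * c + s + 1)) := by
  have : v ((r+1) * c + s) - (1/2 : ℂ) • v (r * c + s) - b • v (r * c + s + 1) =
      (μ s)⁻¹ • e ((r + 1) * c + s) := by
    rw [S.fan r s hr hs]; abel
  rw [this, smul_smul, mul_inv_cancel₀ (hμ s), one_smul]

lemma VS.egap (hK : ∀ s, K s ≠ 0) (S : VS e N A lam b c h K μ v A') (r s : ℕ) (hs : N < s)
    (hsc : s < c) (hj : r * c + s ≤ h * c + N + 1) : e (r * c + s) = K s • v (r * c + s) := by
  rw [S.gap r s hs hsc hj, smul_smul, mul_inv_cancel₀ (hK s), one_smul]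

/-- structural part of Good for the new operator -/
lemma VS.good (he : Orthonormal ℂ e)
    (hd : (Submodule.span ℂ (Set.range e)).topologicalClosure = ⊤)
    (g : Good e N A cons) (hc : N + 3 < c) (hh : 1 ≤ h)
    (hlam : lam ≠ 0) (htop : (A ^ N) (e 0) = lam • e N)
    (hK : ∀ s, K s ≠ 0) (hμ : ∀ s, μ s ≠ 0)
    (S : VS e N A lam b c h K μ v A') (cons' : List (ℕ × ℕ))
    (hcons : ∀ p ∈ cons', 1 ≤ p.1 ∧ p.2 ≤ h * c + N + 1 + 1 ∧ ∃ C : ℝ, 0 ≤ C ∧ C < 7 ∧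
    ∀ x, Tail e p.2 x → ‖(A' ^ p.1) x‖ ≤ C * ‖x‖) : Good e (h * c + N + 1) A' cons' := by
  have hstep := S.step he hd g hc hlam htop hK hμ
  have hv := S.suppv he hd g hc
  have hvN := S.suppN he hd g hc
  have hv0 : v 0 = e 0 := by rw [S.head 0 (Nat.zero_le _)]; simp
  have hpow : ∀ i, (A' ^ i) (e 0) = v i := fun i => by
    rw [← hv0, pow_step hstep, zero_add]
  have hch : c ≤ h * c := Nat.le_mul_of_pos_left c hh
  have hrh : ∀ r, r < h → r * c + c ≤ h * c := fun r hr => by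
    have := Nat.mul_le_mul_right c hr
    rwa [Nat.succ_mul] at this
  have hN : ∀ j, Supp e (h * c + N + 1 + 1) (A' (e j)) := by
    intro j
    rcases idx N c h hc j with h1 | h1 | h1 | ⟨r, s, rfl, hr, hs⟩ | ⟨r, s, rfl, hs, hsc, hr⟩ | h1
    · rw [S.a1 j h1]; exact (g.suppN _).mono (by omega)
    · subst h1; rw [S.a2]; exact (hvN _).smul _
    · rw [S.a5 j h1]; exact supp_zero
    · rw [S.a4 r s hr hs]
      exact (((hvN _).sub ((hvN _).smul _)).sub ((hvN _).smul _)).smul _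
    · have := hrh r hr
      rw [S.a3 r s hs hsc (by omega)]; exact (hvN _).smul _
    · subst h1
      rw [S.a3 h (N+1) (by omega) (by omega) (by omega)]; exact (hvN _).smul _
  refine ⟨S.a5, ?_, ?_, ?_, ?_, ?_, hcons⟩
  · intro j
    rcases idx N c h hc j with h1 | h1 | h1 | ⟨r, s, rfl, hr, hs⟩ | ⟨r, s, rfl, hs, hsc, hr⟩ | h1
    · rw [S.a1 j h1]; exact g.supp j
    · subst h1; rw [S.a2]; exact (hv _).smul _
    · rw [S.a5 j h1]; exact supp_zero
    · rw [S.a4 r s hr hs]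
      have h2 : (r + 1) * c = r * c + c := by ring
      exact (((hv _).sub (((hv _).mono (by omega)).smul _)).sub
        (((hv _).mono (by omega)).smul _)).smul _
    · have := hrh r hr
      rw [S.a3 r s hs hsc (by omega)]; exact (hv _).smul _
    · subst h1
      rw [S.a3 h (N+1) (by omega) (by omega) (by omega)]; exact (hv _).smul _
  · intro x i hi
    have : (innerSL ℂ (e i)).comp A' = 0 := by
      apply ContinuousLinearMap.ext_on (s := Set.range e)
      · rw [dense_iff_closure_eq, ← Submodule.topologicalClosure_coe, hd]; rfl
      · rintro _ ⟨j, rfl⟩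
        simpa using hN j i hi
    simpa using congrArg (fun f => f x) this
  · have := S.a3 h (N+1) (by omega) (by omega) (by omega)
    rw [S.zero _ (by omega), smul_zero] at this
    exact this
  · refine ⟨(K (N+1))⁻¹, inv_ne_zero (hK _), ?_⟩
    rw [hpow]
    exact S.gap h (N+1) (by omega) (by omega) (by omega)
  · set F := Submodule.span ℂ ((fun i => (A' ^ i) (e 0)) '' Set.Iic (h * c + N + 1)) with hF
    have hvF : ∀ i ≤ h * c + N + 1, v i ∈ F := fun i hi =>
      Submodule.subset_span ⟨i, hi, hpow i⟩
    have hhead : ∀ j ≤ N, e j ∈ F := fun j hj => by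
      refine Submodule.span_le.mpr ?_ (g.cyc j hj)
      rintro _ ⟨i, hi, rfl⟩
      change (A ^ i) (e 0) ∈ F
      rw [Set.mem_Iic] at hi
      rw [← S.head i hi]
      exact hvF i (by omega)
    intro j hj
    rcases idx N c h hc j with h1 | h1 | h1 | ⟨r, s, rfl, hr, hs⟩ | ⟨r, s, rfl, hs, hsc, hr⟩ | h1
    · exact hhead j h1.le
    · exact hhead j h1.le
    · omega
    · have h2 : (r + 1) * c = r * c + c := by ring
      have h3 := S.fan r s hr hs
      have h4 : e ((r + 1) * c + s) = μ s • (v ((r+1) * c + s) - (1/2 : ℂ) • v (r * c + s)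
          - b • v (r * c + s + 1)) := S.efan hμ r s hr hs
      rw [h4]
      exact F.smul_mem _ (F.sub_mem (F.sub_mem (hvF _ (by omega))
        (F.smul_mem _ (hvF _ (by omega)))) (F.smul_mem _ (hvF _ (by omega))))
    · have := hrh r hr
      have h3 := S.gap r s hs hsc (by omega)
      have h4 : e (r * c + s) = K s • v (r * c + s) := by
        rw [h3, smul_smul, mul_inv_cancel₀ (hK s), one_smul]
      rw [h4]; exact F.smul_mem _ (hvF _ (by omega))
    · subst h1
      have h3 := S.gap h (N+1) (by omega) (by omega) (by omega)
      have h4 : e (h * c + (N+1)) = K (N+1) • v (h * c + (N+1)) := by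
        rw [h3, smul_smul, mul_inv_cancel₀ (hK _), one_smul]
      rw [h4]; exact F.smul_mem _ (hvF _ (by omega))
end partC

section partD
open Finset
variable {H : Type} [NormedAddCommGroup H] [InnerProductSpace ℂ H]
variable {e : ℕ → H} {N : ℕ} {A : H →L[ℂ] H} {lam b : ℂ} {c h : ℕ} {K μ : ℕ → ℂ}
    {v : ℕ → H} {A' : H →L[ℂ] H} {cons : List (ℕ × ℕ)}
noncomputable def wt (N c h : ℕ) (w δ : ℂ) (j : ℕ) : ℂ :=
  if j ≤ N then 0 else if N < j % c then (if j % c = c - 1 ∨ j = h * c + N + 1 then 0 else w)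
    else (if j % c = N then 0 else δ)

noncomputable def Wop (e : ℕ → H) (N c h : ℕ) (w δ : ℂ) : H →L[ℂ] H :=
  opOn e (range (h * c + N + 2)) (fun j => wt N c h w δ j • e (j + 1))

lemma Wop_norm (he : Orthonormal ℂ e) (N c h : ℕ) {w δ : ℂ} (hδ : ‖δ‖ ≤ ‖w‖) :
    ‖Wop e N c h w δ‖ ≤ ‖w‖ := by
  refine opOn_norm_shift he _ _ (fun j => j + 1) ?_ (norm_nonneg _) ?_
  · intro i _ j _ hij; simpa using hij
  · intro j _
    unfold wt
    split_ifs <;> simp [hδ]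

lemma mod_idx {c : ℕ} (r s : ℕ) (hs : s < c) : (r * c + s) % c = s := by
  rw [mul_comm, Nat.mul_add_mod, Nat.mod_eq_of_lt hs]

lemma Wop_head (he : Orthonormal ℂ e) (N c h : ℕ) (w δ : ℂ) {j : ℕ} (hj : j ≤ N) :
    Wop e N c h w δ (e j) = 0 := by
  rw [Wop, opOn_e he]; simp [wt, hj]

lemma Wop_zero (he : Orthonormal ℂ e) (N c h : ℕ) (w δ : ℂ) {j : ℕ} (hj : h * c + N + 1 < j) :
    Wop e N c h w δ (e j) = 0 := by
  rw [Wop, opOn_e he, if_neg (by simp; omega)]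

lemma Wop_fan (he : Orthonormal ℂ e) {N c h : ℕ} (hc : N + 3 < c) (w δ : ℂ) {r s : ℕ}
    (hr : r < h) (hs : s ≤ N) :
    Wop e N c h w δ (e ((r + 1) * c + s)) =
      if s = N then 0 else δ • e ((r + 1) * c + s + 1) := by
  have h1 : (r + 1) * c ≤ h * c := Nat.mul_le_mul_right c hr
  have h2 : (r + 1) * c = r * c + c := by ring
  rw [Wop, opOn_e he, if_pos (by simp; omega), wt, if_neg (by omega),
    mod_idx _ _ (by omega), if_neg (by omega)]
  split_ifs <;> simp

lemma Wop_gap (he : Orthonormal ℂ e) {N c h : ℕ} (w δ : ℂ) {r s : ℕ}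
    (hr : r < h) (hs : N < s) (hsc : s < c) :
    Wop e N c h w δ (e (r * c + s)) =
      if s = c - 1 then 0 else w • e (r * c + s + 1) := by
  have h1 : (r + 1) * c ≤ h * c := Nat.mul_le_mul_right c hr
  have h2 : (r + 1) * c = r * c + c := by ring
  rw [Wop, opOn_e he, if_pos (by simp; omega), wt, if_neg (by omega),
    mod_idx _ _ (by omega), if_pos (by omega)]
  have h3 : ¬ (r * c + s = h * c + N + 1) := by omega
  simp only [h3, or_false]
  split_ifs <;> simp

lemma Wop_last (he : Orthonormal ℂ e) {N c h : ℕ} (hc : N + 3 < c) (w δ : ℂ) :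
    Wop e N c h w δ (e (h * c + (N + 1))) = 0 := by
  rw [Wop, opOn_e he, if_pos (by simp; omega), wt, if_neg (by omega),
    mod_idx _ _ (by omega), if_pos (by omega), if_pos (by right; omega), zero_smul]

lemma A_Wop (he : Orthonormal ℂ e)
    (hd : (Submodule.span ℂ (Set.range e)).topologicalClosure = ⊤)
    (g : Good e N A cons) (w δ : ℂ) : A * Wop e N c h w δ = 0 := by
  apply ext_e hd
  intro j
  change A (Wop e N c h w δ (e j)) = 0
  by_cases hj : j ≤ N
  · rw [Wop_head he _ _ _ _ _ hj, map_zero]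
  · rw [Wop, opOn_e he]
    split_ifs
    · rw [map_smul, g.zero (j+1) (by omega), smul_zero]
    · rw [map_zero]

lemma Wop_A (he : Orthonormal ℂ e)
    (hd : (Submodule.span ℂ (Set.range e)).topologicalClosure = ⊤)
    (g : Good e N A cons) (w δ : ℂ) : Wop e N c h w δ * A = 0 := by
  ext x
  change Wop e N c h w δ (A x) = (0 : H →L[ℂ] H) (A x)
  exact map_congr he hd (g.suppN x) _ _ fun j hj => by
    rw [Wop_head he _ _ _ _ _ (by omega)]; rfl

lemma add_pow_of {X Y : H →L[ℂ] H} (h1 : X * Y = 0) (h2 : Y * X = 0) (a : ℕ) :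
    (X + Y) ^ (a + 1) = X ^ (a + 1) + Y ^ (a + 1) := by
  induction a with
  | zero => simp
  | succ a ih =>
    rw [pow_succ, ih, add_mul, mul_add, mul_add, pow_succ X a, pow_succ Y a, mul_assoc _ X Y, h1,
      mul_assoc _ Y X, h2]
    simp [pow_succ]

lemma B_bound (he : Orthonormal ℂ e)
    (hd : (Submodule.span ℂ (Set.range e)).topologicalClosure = ⊤)
    (g : Good e N A cons) {w δ : ℂ} (hδ : ‖δ‖ ≤ ‖w‖) {a k : ℕ} (hw : ‖w‖ ^ a ≤ 2) (ha : 1 ≤ a)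
    {C : ℝ} (hC : 0 ≤ C)
    (hA : ∀ x, Tail e k x → ‖(A ^ a) x‖ ≤ C * ‖x‖) (x : H) (hx : Tail e k x) :
    ‖((A + Wop e N c h w δ) ^ a) x‖ ≤ max C 2 * ‖x‖ := by
  obtain ⟨a, rfl⟩ : ∃ a', a = a' + 1 := ⟨a - 1, by omega⟩
  set W := Wop e N c h w δ with hW
  rw [add_pow_of (A_Wop he hd g w δ) (Wop_A he hd g w δ)]
  have hAP : ∀ y, A (Pr e (N+1) y) = A y := by
    intro y
    have : A * Pr e (N+1) = A := ext_e hd fun j => by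
      change A (Pr e (N+1) (e j)) = _
      rw [Pr_e he]
      split_ifs with hj
      · rfl
      · rw [map_zero, g.zero j (by omega)]
    exact congrArg (fun f => f y) this
  have hWP : ∀ y, W (Pr e (N+1) y) = 0 := fun y =>
    map_congr he hd (supp_Pr he (N+1) y) W 0 fun j hj => Wop_head he _ _ _ _ _ (by omega)
  have hPA : ∀ y, Pr e (N+1) (A y) = A y := fun y => (g.suppN y).eq he hd
  have hPW : ∀ y, Pr e (N+1) (W y) = 0 := by
    intro y
    have : Pr e (N+1) * W = 0 := ext_e hd fun j => by
      change Pr e (N+1) (W (e j)) = 0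
      by_cases hj : j ≤ N
      · rw [hW, Wop_head he _ _ _ _ _ hj, map_zero]
      · rw [hW, Wop, opOn_e he]
        split_ifs
        · rw [map_smul, Pr_e he, if_neg (by omega), smul_zero]
        · rw [map_zero]
    exact congrArg (fun f => f y) this
  have e1 : (A ^ (a+1)) x = (A ^ (a+1)) (Pr e (N+1) x) := by
    rw [pow_succ]; exact congrArg (A ^ a) (hAP x).symm
  have e2 : (W ^ (a+1)) x = (W ^ (a+1)) (x - Pr e (N+1) x) := by
    rw [pow_succ]
    refine congrArg (W ^ a) ?_
    change W x = W (x - Pr e (N+1) x)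
    rw [map_sub, hWP, sub_zero]
  have e3 : Pr e (N+1) ((A ^ (a+1)) x) = (A ^ (a+1)) x := by
    rw [pow_succ']; exact hPA _
  have e4 : Pr e (N+1) ((W ^ (a+1)) x) = 0 := by
    rw [pow_succ']; exact hPW _
  have ht : Tail e k (Pr e (N+1) x) := fun i hi => by
    rw [inner_Pr he, hx i hi]; simp
  have b1 := hA _ ht
  rw [← e1] at b1
  have b2 : ‖(W ^ (a+1)) x‖ ≤ 2 * ‖x - Pr e (N+1) x‖ := by
    rw [e2]
    refine ((W ^ (a+1)).le_opNorm _).trans ?_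
    gcongr
    refine (norm_pow_le' W (Nat.succ_pos a)).trans (le_trans ?_ hw)
    gcongr
    exact Wop_norm he N c h hδ
  refine le_of_sq_le_sq ?_ (by positivity)
  have q := pyth he (N+1) ((A ^ (a+1) + W ^ (a+1)) x)
  change ‖(A ^ (a+1) + W ^ (a+1)) x‖ ^ 2 = ‖Pr e (N+1) ((A ^ (a+1)) x + (W ^ (a+1)) x)‖ ^ 2 +
    ‖(A ^ (a+1)) x + (W ^ (a+1)) x - Pr e (N+1) ((A ^ (a+1)) x + (W ^ (a+1)) x)‖ ^ 2 at q
  rw [map_add, e3, e4, add_zero, add_sub_cancel_left] at q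
  rw [q, mul_pow, pyth he (N+1) x, mul_add]
  have m1 : C ≤ max C 2 := le_max_left _ _
  have m2 : 2 ≤ max C 2 := le_max_right _ _
  gcongr
  · rw [← mul_pow]
    gcongr
    exact b1.trans (by gcongr)
  · rw [← mul_pow]
    gcongr
    exact b2.trans (by gcongr)

lemma VS.R_norm (he : Orthonormal ℂ e)
    (hd : (Submodule.span ℂ (Set.range e)).topologicalClosure = ⊤)
    (g : Good e N A cons) (hc : N + 3 < c) (hh : 1 ≤ h)
    (hK : ∀ s, K s ≠ 0) (hμ : ∀ s, μ s ≠ 0) {w δ : ℂ}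
    (hw : ∀ s, K s = w * K (s + 1)) (hδ : ∀ s, μ s = δ * μ (s + 1))
    (S : VS e N A lam b c h K μ v A') {η : ℝ}
    (h1 : ‖lam⁻¹ • v (N + 1)‖ ≤ η) (h2 : ∀ r < h, ‖K (c - 1) • v ((r + 1) * c)‖ ≤ η)
    (h3 : ∀ r < h, ‖μ N • (v ((r + 1) * c + N + 1) - (1/2 : ℂ) • v (r * c + N + 1)
      - b • v (r * c + N + 2))‖ ≤ η) :
    ‖A' - (A + Wop e N c h w δ)‖ ≤ (2 * h + 1) * η := by
  set W := Wop e N c h w δ with hW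
  set R := A' - (A + W) with hR
  have hch : c ≤ h * c := Nat.le_mul_of_pos_left c hh
  have hrh : ∀ r, r < h → r * c + c ≤ h * c := fun r hr => by
    have := Nat.mul_le_mul_right c hr
    rwa [Nat.succ_mul] at this
  have hη : 0 ≤ η := (norm_nonneg _).trans h1
  set E : Finset ℕ := image (fun r => r * c + N) (range (h + 1)) ∪
    image (fun r => r * c + (c - 1)) (range h) with hE
  have hcard : (#E : ℝ) ≤ 2 * h + 1 := by
    have a1 := card_union_le (image (fun r => r * c + N) (range (h + 1)))
      (image (fun r => r * c + (c - 1)) (range h))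
    have a2 := card_image_le (s := range (h+1)) (f := fun r => r * c + N)
    have a3 := card_image_le (s := range h) (f := fun r => r * c + (c - 1))
    rw [card_range] at a2 a3
    have : #E ≤ 2 * h + 1 := by rw [hE]; omega
    exact_mod_cast this
  have key : ∀ j, (j ∈ E → ‖R (e j)‖ ≤ η) ∧ (j ∉ E → R (e j) = 0) := by
    intro j
    have hRj : R (e j) = A' (e j) - (A (e j) + W (e j)) := rfl
    have triv : R (e j) = 0 → (j ∈ E → ‖R (e j)‖ ≤ η) ∧ (j ∉ E → R (e j) = 0) :=
      fun hz => ⟨fun _ => by rw [hz, norm_zero]; exact hη, fun _ => hz⟩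
    rcases idx N c h hc j with q | q | q | ⟨r, s, rfl, hr, hs⟩ | ⟨r, s, rfl, hs, hsc, hr⟩ | q
    · apply triv
      rw [hRj, S.a1 j q, hW, Wop_head he _ _ _ _ _ q.le]; simp
    · subst q
      refine ⟨fun _ => ?_, fun hn => absurd ?_ hn⟩
      · rw [hRj, S.a2, hW, Wop_head he _ _ _ _ _ le_rfl, g.last]; simpa using h1
      · rw [hE, mem_union]; left; rw [mem_image]; exact ⟨0, by simp, by simp⟩
    · apply triv
      have : h * c + N + 1 < j := q
      rw [hRj, S.a5 j q, hW, Wop_zero he _ _ _ _ _ q, g.zero j (by omega)]; simp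
    · have x2 : (r + 1) * c = r * c + c := by ring
      have hz : A (e ((r + 1) * c + s)) = 0 := g.zero _ (by omega)
      by_cases hsN : s = N
      · subst hsN
        refine ⟨fun _ => ?_, fun hn => absurd ?_ hn⟩
        · rw [hRj, hz, hW, Wop_fan he hc _ _ hr hs, if_pos rfl, S.a4 r s hr hs]
          simpa using h3 r hr
        · rw [hE, mem_union]; left; rw [mem_image]; exact ⟨r+1, by simp; omega, by simp⟩
      · apply triv
        rw [hRj, hz, hW, Wop_fan he hc _ _ hr hs, if_neg hsN, S.a4 r s hr hs]
        have := S.efan hμ r (s+1) hr (by omega)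
        have e1 : (r + 1) * c + (s + 1) = (r + 1) * c + s + 1 := by ring
        have e2 : r * c + (s + 1) = r * c + s + 1 := by ring
        rw [e1, e2] at this
        rw [this, hδ s, smul_smul, zero_add, sub_self]
    · have hz : A (e (r * c + s)) = 0 := g.zero _ (by omega)
      have x1 := hrh r hr
      by_cases hsN : s = c - 1
      · refine ⟨fun _ => ?_, fun hn => absurd ?_ hn⟩
        · rw [hRj, hz, hW, Wop_gap he _ _ hr hs hsc, if_pos hsN, S.a3 r s hs hsc (by omega)]
          have : r * c + s + 1 = (r + 1) * c := by rw [add_mul]; omega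
          rw [this, hsN]
          simpa using h2 r hr
        · rw [hE, mem_union]; right; rw [mem_image]; exact ⟨r, by simp; omega, by simp [hsN]⟩
      · apply triv
        rw [hRj, hz, hW, Wop_gap he _ _ hr hs hsc, if_neg hsN, S.a3 r s hs hsc (by omega)]
        have := S.egap hK r (s+1) (by omega) (by omega) (by omega)
        have e1 : r * c + (s + 1) = r * c + s + 1 := by ring
        rw [e1] at this
        rw [this, hw s, smul_smul, zero_add, sub_self]
    · apply triv
      subst q
      rw [hRj, S.a3 h (N+1) (by omega) (by omega) (by omega), S.zero _ (by omega), hW,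
        Wop_last he hc, g.zero _ (by omega)]; simp
  have hRE : R = opOn e E (fun j => R (e j)) := ext_e hd fun j => by
    rw [opOn_e he]
    split_ifs with hj
    · rfl
    · exact (key j).2 hj
  rw [hRE]
  refine (opOn_norm_sum he _ _).trans ((sum_le_card_nsmul E _ η fun j hj => (key j).1 hj).trans ?_)
  rw [nsmul_eq_mul]
  gcongr
end partD

section partE
open Finset
variable {H : Type} [NormedAddCommGroup H] [InnerProductSpace ℂ H]
variable {e : ℕ → H} {N : ℕ} {A : H →L[ℂ] H} {cons : List (ℕ × ℕ)} {lam b : ℂ} {c h : ℕ}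
  {K μ : ℕ → ℂ} {v : ℕ → H} {A' : H →L[ℂ] H}
noncomputable def pp (b : ℂ) (X : H →L[ℂ] H) : H →L[ℂ] H := (1/2 : ℂ) • (1 : H →L[ℂ] H) + b • X

lemma pp_apply (b : ℂ) (X : H →L[ℂ] H) (x : H) : pp b X x = (1/2 : ℂ) • x + b • X x := rfl

lemma VS.vp (hstep : ∀ j, A' (v j) = v (j + 1))
    (S : VS e N A lam b c h K μ v A') {s : ℕ} (hs : s ≤ N) (r : ℕ) (hr : r ≤ h) :
    v (r * c + s) = (pp b A' ^ r) (v s) +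
      (μ s)⁻¹ • ∑ k ∈ range r, (pp b A' ^ k) (e ((r - k) * c + s)) := by
  induction r with
  | zero => simp
  | succ r ih =>
    have h1 := ih (by omega)
    have h2 : v ((r + 1) * c + s) = pp b A' (v (r * c + s)) + (μ s)⁻¹ • e ((r + 1) * c + s) := by
      rw [S.fan r s (by omega) hs, pp_apply, hstep]
    rw [h2, h1, sum_range_succ', map_add, map_smul, map_sum, smul_add]
    simp only [pow_succ', mul_apply_eq_comp, Nat.add_sub_add_right, pow_zero,
      one_apply_eq_self, Nat.sub_zero]
    abel

lemma VS.Spow (hc : N + 3 < c) (hh : 1 ≤ h) (hK : ∀ s, K s ≠ 0) (hμ : ∀ s, μ s ≠ 0)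
    (he : Orthonormal ℂ e)
    (hd : (Submodule.span ℂ (Set.range e)).topologicalClosure = ⊤)
    (hstep : ∀ j, A' (v j) = v (j + 1))
    (S : VS e N A lam b c h K μ v A') :
    A' ^ c * (1 - Pr e (N+1)) = opOn e (Ioc N (h * c + N + 1 - c)) (fun j => e (j + c))
      - ∑ k ∈ range h, (pp b A') ^ (k + 1) *
        opOn e (Ico (h * c) (h * c + N + 1)) (fun j => e (j - k * c))
      - opOn e (Ico (h * c) (h * c + N + 1))
        (fun j => μ (j - h * c) • (pp b A' ^ (h + 1)) (v (j - h * c))) := by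
  have hps := pow_step hstep c
  have hch : c ≤ h * c := Nat.le_mul_of_pos_left c hh
  apply ext_e hd
  intro j
  have L : (A' ^ c * (1 - Pr e (N+1))) (e j) = if j ≤ N then 0 else (A' ^ c) (e j) := by
    change (A' ^ c) (e j - Pr e (N+1) (e j)) = _
    rw [Pr_e he]
    by_cases hj : j ≤ N
    · rw [if_pos (by omega), if_pos hj, sub_self, map_zero]
    · rw [if_neg (by omega), if_neg hj, sub_zero]
  rw [L]
  simp only [sub_apply, _root_.sum_apply,
    mul_apply_eq_comp, opOn_e he, mem_Ioc, mem_Ico]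
  rcases idx N c h hc j with h1 | h1 | h1 | ⟨r, s, rfl, hr, hs⟩ | ⟨r, s, rfl, hs, hsc, hr⟩ | h1
  · rw [if_pos h1.le, if_neg (by omega), if_neg (by omega)]; 
    have : ¬ (h * c ≤ j ∧ j < h * c + N + 1) := by omega
    simp only [this, if_false, map_zero, sum_const_zero, sub_zero]
  · rw [if_pos h1.le, if_neg (by omega), if_neg (by omega)]; 
    have : ¬ (h * c ≤ j ∧ j < h * c + N + 1) := by omega
    simp only [this, if_false, map_zero, sum_const_zero, sub_zero]
  · rw [if_neg (by omega), if_neg (by omega), if_neg (by omega)]; 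
    have : ¬ (h * c ≤ j ∧ j < h * c + N + 1) := by omega
    have h2 : A' (e j) = 0 := S.a5 j h1
    simp only [this, if_false, map_zero, sum_const_zero, sub_zero]
    obtain ⟨c', rfl⟩ : ∃ c', c = c' + 1 := ⟨c - 1, by omega⟩
    rw [pow_succ]
    change (A' ^ c') (A' (e j)) = 0
    rw [h2, map_zero]
  · have h2 : (r + 1) * c = r * c + c := by ring
    have h3 : (r + 1 + 1) * c = r * c + c + c := by ring
    have key : (A' ^ c) (e ((r + 1) * c + s)) = μ s • (v ((r + 1 + 1) * c + s) -
        pp b A' (v ((r + 1) * c + s))) := by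
      rw [S.efan hμ r s hr hs, map_smul, map_sub, map_sub, map_smul, map_smul, hps, hps, hps,
        pp_apply, hstep, sub_sub]
      congr 2
      · rw [h3]; congr 1; omega
      · rw [h2]; congr 3 <;> omega
    rw [if_neg (by omega), key]
    by_cases hrh : r + 1 < h
    · have h4 : (r + 1 + 1) * c ≤ h * c := Nat.mul_le_mul_right c hrh
      have : ¬ (h * c ≤ (r+1)*c+s ∧ (r+1)*c+s < h * c + N + 1) := by omega
      rw [if_pos (by omega), if_neg this]
      simp only [this, if_false, map_zero, sum_const_zero, sub_zero]
      rw [S.fan (r+1) s hrh hs, pp_apply, hstep, add_sub_cancel_left, smul_smul,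
        mul_inv_cancel₀ (hμ s), one_smul]
      congr 1; omega
    · have : r + 1 = h := by omega
      rw [if_neg (by rw [this] at h2 ⊢; omega), if_pos (by rw [this]; omega)]
      have h5 : (h * c ≤ (r+1)*c+s ∧ (r+1)*c+s < h * c + N + 1) := by rw [this]; omega
      simp only [h5, and_self, if_true]
      rw [S.zero _ (by rw [← this]; omega), this, S.vp hstep hs h le_rfl, map_add, map_smul, map_sum,
        zero_sub, neg_add, smul_add, smul_neg, smul_neg, smul_smul, mul_inv_cancel₀ (hμ s),
        one_smul, add_tsub_cancel_left, zero_sub, pow_succ']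
      have h6 : ∑ x ∈ range h, (pp b A') ((pp b A' ^ x) (e ((h - x) * c + s))) =
          ∑ x ∈ range h, (pp b A' ^ (x + 1)) (e (h * c + s - x * c)) := by
        refine sum_congr rfl fun k hk => ?_
        have : (h - k) * c + s = h * c + s - k * c := by
          have := mem_range.mp hk
          have h7 : k * c ≤ h * c := Nat.mul_le_mul_right c this.le
          rw [Nat.sub_mul]; omega
        rw [this, pow_succ']; rfl
      rw [h6]
      simp only [mul_apply_eq_comp]
      abel
  · have h2 : (r + 1) * c = r * c + c := by ring
    have h4 : (r + 1) * c ≤ h * c := Nat.mul_le_mul_right c hr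
    have : ¬ (h * c ≤ r*c+s ∧ r*c+s < h * c + N + 1) := by omega
    rw [if_neg (by omega), if_neg this]
    simp only [this, if_false, map_zero, sum_const_zero, sub_zero]
    rw [S.egap hK r s hs hsc (by omega), map_smul, hps]
    have h5 : r * c + s + c = (r + 1) * c + s := by omega
    rw [h5]
    split_ifs with h6
    · rw [S.egap hK (r+1) s hs hsc (by omega)]
    · rw [S.zero _ (by omega), smul_zero]
  · subst h1
    have : ¬ (h * c ≤ h*c+(N+1) ∧ h*c+(N+1) < h * c + N + 1) := by omega
    rw [if_neg (by omega), if_neg (by omega), if_neg this]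
    simp only [this, if_false, map_zero, sum_const_zero, sub_zero]
    rw [S.egap hK h (N+1) (by omega) (by omega) (by omega), map_smul, hps, S.zero _ (by omega), smul_zero]

lemma pp_norm (b : ℂ) (X : H →L[ℂ] H) : ‖pp b X‖ ≤ 1/2 + ‖b‖ * ‖X‖ := by
  unfold pp
  refine (norm_add_le _ _).trans (add_le_add ?_ (norm_smul b X).le)
  refine (norm_smul _ _).le.trans ?_
  have : ‖(1 : H →L[ℂ] H)‖ ≤ 1 := ContinuousLinearMap.norm_id_le
  norm_num
  linarith

lemma pow_norm_le {X : H →L[ℂ] H} {L : ℝ} (hX : ‖X‖ ≤ L) (a : ℕ) : ‖X ^ a‖ ≤ L ^ a := by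
  induction a with
  | zero =>
    rw [pow_zero, pow_zero]
    exact ContinuousLinearMap.norm_id_le
  | succ a ih =>
    rw [pow_succ, pow_succ]
    exact (norm_mul_le _ _).trans (mul_le_mul ih hX (norm_nonneg _) ((norm_nonneg _).trans ih))

lemma pp_fan (he : Orthonormal ℂ e)
    (hd : (Submodule.span ℂ (Set.range e)).topologicalClosure = ⊤)
    (g : Good e N A cons) (hc : N + 3 < c) (w δ : ℂ) (hb : ‖b‖ * ‖δ‖ ≤ 1/4)
    {k : ℕ} (hk : k < h) (m : ℕ) :
    ‖(pp b (A + Wop e N c h w δ)) ^ m *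
        opOn e (Ico (h * c) (h * c + N + 1)) (fun j => e (j - k * c))‖ ≤ (3/4) ^ m := by
  obtain ⟨r, rfl⟩ : ∃ r, h = k + 1 + r := ⟨h - (k+1), by omega⟩
  set h := k + 1 + r with hh
  set B := A + Wop e N c h w δ with hB
  set Q := opOn e (Ico ((r+1) * c) ((r+1) * c + N + 1)) e with hQ
  set D := opOn e (Ico ((r+1) * c) ((r+1) * c + N)) (fun j => δ • e (j + 1)) with hD
  set Y := opOn e (Ico (h * c) (h * c + N + 1)) (fun j => e (j - k * c)) with hY
  have hhc : h * c = (r+1) * c + k * c := by rw [hh]; ring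
  have hrc : (r+1) * c = r * c + c := by ring
  have hYn : ‖Y‖ ≤ 1 := by
    have := opOn_norm_shift he (Ico (h * c) (h * c + N + 1)) (fun _ => 1) (fun j => j - k * c)
      (by intro x hx y hy hxy; simp at hx hy hxy; omega) zero_le_one (by simp)
    simpa using this
  have hDn : ‖D‖ ≤ ‖δ‖ := by
    refine opOn_norm_shift he _ (fun _ => δ) (fun j => j + 1) ?_ (norm_nonneg _) (by simp)
    intro x _ y _ hxy; simpa using hxy
  have hQY : Q * Y = Y := ext_e hd fun j => by
    change Q (Y (e j)) = Y (e j)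
    rw [hY, opOn_e he]
    split_ifs with h1
    · rw [hQ, opOn_e he, if_pos]
      simp at h1 ⊢; omega
    · exact map_zero _
  have hBQ : B * Q = D * Q := ext_e hd fun j => by
    change B (Q (e j)) = D (Q (e j))
    rw [hQ, opOn_e he]
    split_ifs with h1
    · obtain ⟨s, rfl⟩ : ∃ s, j = (r+1)*c + s := ⟨j - (r+1)*c, by simp at h1; omega⟩
      simp at h1
      rw [hB, add_apply, g.zero _ (by omega),
        Wop_fan he hc w δ (by omega) (by omega), hD, opOn_e he, zero_add]
      by_cases h2 : s = N
      · rw [if_pos h2, if_neg (by simp; omega)]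
      · rw [if_neg h2, if_pos (by simp; omega)]
    · simp
  have hQD : Q * (D * Q) = D * Q := ext_e hd fun j => by
    change Q (D (Q (e j))) = D (Q (e j))
    rw [hQ, opOn_e he]
    split_ifs with h1
    · rw [hD, opOn_e he]
      split_ifs with h2
      · rw [map_smul, opOn_e he, if_pos]
        simp at h2 ⊢; omega
      · exact map_zero _
    · simp
  have hQQ : Q * Q = Q := ext_e hd fun j => by
    change Q (Q (e j)) = (Q (e j))
    rw [hQ, opOn_e he]
    split_ifs with h1
    · rw [opOn_e he, if_pos h1]
    · simp
  have hp1 : pp b B * Q = pp b D * Q := by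
    simp only [pp, add_mul, smul_mul_assoc, hBQ]
  have hp2 : Q * (pp b D * Q) = pp b D * Q := by
    simp only [pp, add_mul, smul_mul_assoc, mul_add, mul_smul_comm, hQD, one_mul, hQQ]
  have hp3 : ∀ m, pp b B ^ m * Q = pp b D ^ m * Q := by
    intro m
    induction m with
    | zero => simp
    | succ m ih =>
      rw [pow_succ, mul_assoc, hp1, ← hp2, ← mul_assoc, ih, mul_assoc, hp2, ← mul_assoc, ← pow_succ]
  have hp4 : pp b B ^ m * Y = pp b D ^ m * Y := by
    rw [← hQY, ← mul_assoc, hp3, mul_assoc]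
  rw [hp4]
  have h5 : ‖pp b D‖ ≤ 3/4 := by
    have := pp_norm b D
    have h6 : ‖b‖ * ‖D‖ ≤ ‖b‖ * ‖δ‖ := by gcongr
    linarith
  calc ‖pp b D ^ m * Y‖ ≤ ‖pp b D ^ m‖ * ‖Y‖ := norm_mul_le _ _
    _ ≤ (3/4)^m * 1 := mul_le_mul (pow_norm_le h5 m) hYn (norm_nonneg _) (by positivity)
    _ = _ := mul_one _

lemma VS.tail_bound (he : Orthonormal ℂ e)
    (hd : (Submodule.span ℂ (Set.range e)).topologicalClosure = ⊤)
    (g : Good e N A cons) (hc : N + 3 < c) (hh : 1 ≤ h) (hK : ∀ s, K s ≠ 0) (hμ : ∀ s, μ s ≠ 0)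
    (hstep : ∀ j, A' (v j) = v (j + 1))
    (S : VS e N A lam b c h K μ v A') (w δ : ℂ) (hb : ‖b‖ * ‖δ‖ ≤ 1/4) {ε1 : ℝ}
    (hε : h * ε1 ≤ 1)
    (hp : ∀ m ≤ h, ‖pp b A' ^ m - pp b (A + Wop e N c h w δ) ^ m‖ ≤ ε1)
    (hZ : ∑ s ∈ range (N+1), ‖μ s • (pp b A' ^ (h + 1)) (v s)‖ ≤ 1)
    (x : H) (hx : Tail e (N+1) x) : ‖(A' ^ c) x‖ ≤ 6 * ‖x‖ := by
  have h1 : (A' ^ c) x = (A' ^ c * (1 - Pr e (N+1))) x := by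
    change _ = (A' ^ c) (x - Pr e (N+1) x)
    congr 1
    have : Pr e (N+1) x = 0 := by
      rw [Pr_apply]; exact sum_eq_zero fun j hj => by rw [hx j (mem_range.mp hj), zero_smul]
    rw [this, sub_zero]
  rw [h1]
  refine (ContinuousLinearMap.le_opNorm _ _).trans (mul_le_mul_of_nonneg_right ?_ (norm_nonneg _))
  rw [S.Spow hc hh hK hμ he hd hstep]
  have n1 : ‖opOn e (Ioc N (h * c + N + 1 - c)) (fun j => e (j + c))‖ ≤ 1 := by
    have := opOn_norm_shift he (Ioc N (h * c + N + 1 - c)) (fun _ => 1) (fun j => j + c)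
      (by intro x hx y hy hxy; simpa using hxy) zero_le_one (by simp)
    simpa using this
  have n3 : ‖opOn e (Ico (h * c) (h * c + N + 1))
        (fun j => μ (j - h * c) • (pp b A' ^ (h + 1)) (v (j - h * c)))‖ ≤ 1 := by
    refine (opOn_norm_sum he _ _).trans (le_trans (le_of_eq ?_) hZ)
    rw [Finset.sum_Ico_eq_sum_range, show h * c + N + 1 - h * c = N + 1 by omega]
    simp
  have n2 : ‖∑ k ∈ range h, (pp b A') ^ (k + 1) *
        opOn e (Ico (h * c) (h * c + N + 1)) (fun j => e (j - k * c))‖ ≤ 4 := by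
    have hk : ∀ k ∈ range h, ‖(pp b A') ^ (k + 1) *
        opOn e (Ico (h * c) (h * c + N + 1)) (fun j => e (j - k * c))‖ ≤ (3/4)^(k+1) + ε1 := by
      intro k hk
      rw [mem_range] at hk
      have a1 := pp_fan he hd g hc w δ hb hk (k+1)
      have a2 := hp (k+1) hk
      have hYn : ‖opOn e (Ico (h * c) (h * c + N + 1)) (fun j => e (j - k * c))‖ ≤ 1 := by
        have hkc : k * c ≤ h * c := Nat.mul_le_mul_right c hk.le
        have := opOn_norm_shift he (Ico (h * c) (h * c + N + 1)) (fun _ => 1) (fun j => j - k * c)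
          (by intro x hx y hy hxy; simp at hx hy hxy; omega) zero_le_one (by simp)
        simpa using this
      set Y := opOn e (Ico (h * c) (h * c + N + 1)) (fun j => e (j - k * c))
      have : pp b A' ^ (k+1) * Y = pp b (A + Wop e N c h w δ) ^ (k+1) * Y +
        (pp b A' ^ (k+1) - pp b (A + Wop e N c h w δ) ^ (k+1)) * Y := by rw [sub_mul]; abel
      rw [this]
      refine (norm_add_le _ _).trans (add_le_add a1 ((norm_mul_le _ _).trans ?_))
      calc _ ≤ ε1 * 1 := mul_le_mul a2 hYn (norm_nonneg _) ((norm_nonneg _).trans a2)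
        _ = _ := mul_one _
    refine (norm_sum_le _ _).trans ((sum_le_sum hk).trans ?_)
    rw [sum_add_distrib, sum_const, card_range, nsmul_eq_mul]
    have : ∑ i ∈ range h, (3/4 : ℝ)^(i+1) ≤ 3 := by
      have : ∑ i ∈ range h, (3/4 : ℝ)^(i+1) = 3 * (1 - (3/4)^h) := by
        simp only [pow_succ]
        rw [← sum_mul, geom_sum_eq (by norm_num)]; ring
      rw [this]
      have : (0:ℝ) ≤ (3/4)^h := by positivity
      linarith
    linarith
  refine (norm_sub_le _ _).trans ?_
  refine (add_le_add (norm_sub_le _ _) n3).trans ?_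
  linarith
end partE

section partF
open Finset
variable {H : Type} [NormedAddCommGroup H] [InnerProductSpace ℂ H]
variable {e : ℕ → H} {N : ℕ} {A : H →L[ℂ] H} {cons : List (ℕ × ℕ)} {lam b : ℂ} {c h : ℕ}
  {K μ : ℕ → ℂ} {v : ℕ → H} {A' : H →L[ℂ] H}
lemma Good.exists_Γ (g : Good e N A cons) : ∃ Γ : ℝ, 0 ≤ Γ ∧ ∀ (R : H →L[ℂ] H) (η : ℝ), 0 ≤ η →
    (∀ i ≤ N, ‖R ((A ^ i) (e 0))‖ ≤ η) → ∀ j ≤ N, ‖R (e j)‖ ≤ Γ * η := by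
  have key : ∀ x ∈ Submodule.span ℂ ((fun i => (A ^ i) (e 0)) '' Set.Iic N),
      ∃ Γ : ℝ, 0 ≤ Γ ∧ ∀ (R : H →L[ℂ] H) (η : ℝ), 0 ≤ η →
        (∀ i ≤ N, ‖R ((A ^ i) (e 0))‖ ≤ η) → ‖R x‖ ≤ Γ * η := by
    intro x hx
    induction hx using Submodule.span_induction with
    | mem x h =>
      obtain ⟨i, hi, rfl⟩ := h
      exact ⟨1, zero_le_one, fun R η _ h => by rw [one_mul]; exact h i hi⟩
    | zero => exact ⟨0, le_rfl, fun R η _ h => by simp⟩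
    | add x y _ _ hx hy =>
      obtain ⟨a, ha, h1⟩ := hx
      obtain ⟨a', ha', h2⟩ := hy
      refine ⟨a + a', add_nonneg ha ha', fun R η h0 h => ?_⟩
      rw [map_add, add_mul]
      exact (norm_add_le _ _).trans (add_le_add (h1 R η h0 h) (h2 R η h0 h))
    | smul z x _ hx =>
      obtain ⟨a, ha, h1⟩ := hx
      refine ⟨‖z‖ * a, by positivity, fun R η h0 h => ?_⟩
      rw [map_smul, norm_smul, mul_assoc]
      exact mul_le_mul_of_nonneg_left (h1 R η h0 h) (norm_nonneg _)
  choose! Γ h0 hΓ using fun j (hj : j ≤ N) => key (e j) (g.cyc j hj)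
  refine ⟨∑ j ∈ range (N+1), Γ j, sum_nonneg fun j hj => h0 j (by simp at hj; omega),
    fun R η hη h j hj => (hΓ j hj R η hη h).trans (mul_le_mul_of_nonneg_right ?_ hη)⟩
  exact single_le_sum (f := Γ) (fun j hj => h0 j (by simp at hj; omega)) (by simp; omega)

lemma pp_decay (b : ℂ) (A : H →L[ℂ] H) (k : ℕ) : ∀ x, (A ^ k) x = 0 →
    ∃ C : ℝ, 0 ≤ C ∧ ∀ n, ‖(pp b A ^ n) x‖ ≤ C * (3/4) ^ n := by
  induction k with
  | zero =>
    intro x hx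
    have : x = 0 := by simpa using hx
    exact ⟨0, le_rfl, fun n => by simp [this]⟩
  | succ k ih =>
    intro x hx
    rw [pow_succ] at hx
    obtain ⟨C, hC, h⟩ := ih (A x) hx
    refine ⟨max ‖x‖ (4 * (‖b‖ * C)), le_max_of_le_left (norm_nonneg _), fun n => ?_⟩
    induction n with
    | zero => simp
    | succ n ihn =>
      have h1 : (pp b A ^ (n+1)) x = (1/2 : ℂ) • (pp b A ^ n) x + b • (pp b A ^ n) (A x) := by
        rw [pow_succ]
        change (pp b A ^ n) (pp b A x) = _
        rw [pp_apply, map_add, map_smul, map_smul]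
      rw [h1]
      refine (norm_add_le _ _).trans ?_
      rw [norm_smul, norm_smul]
      have h2 := h n
      have h3 : ‖b‖ * ‖(pp b A ^ n) (A x)‖ ≤ ‖b‖ * (C * (3/4)^n) :=
        mul_le_mul_of_nonneg_left h2 (norm_nonneg _)
      have h4 : (4 * (‖b‖ * C)) * (3/4)^n ≤ max ‖x‖ (4 * (‖b‖ * C)) * (3/4)^n :=
        mul_le_mul_of_nonneg_right (le_max_right _ _) (by positivity)
      have h5 : ‖(1/2 : ℂ)‖ = 1/2 := by norm_num
      rw [h5, pow_succ]
      nlinarith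

lemma pp_head (he : Orthonormal ℂ e)
    (hd : (Submodule.span ℂ (Set.range e)).topologicalClosure = ⊤)
    (g : Good e N A cons) (w δ : ℂ) (m : ℕ) : ∀ x, Supp e (N+1) x →
      (pp b (A + Wop e N c h w δ) ^ m) x = (pp b A ^ m) x := by
  induction m with
  | zero => simp
  | succ m ih =>
    intro x hx
    rw [pow_succ, pow_succ]
    change (pp b (A + Wop e N c h w δ) ^ m) (pp b (A + Wop e N c h w δ) x) =
      (pp b A ^ m) (pp b A x)
    have h1 : Wop e N c h w δ x = (0 : H →L[ℂ] H) x :=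
      map_congr he hd hx _ _ fun j hj => by rw [Wop_head he _ _ _ _ _ (by omega)]; rfl
    have h2 : pp b (A + Wop e N c h w δ) x = pp b A x := by
      rw [pp_apply, pp_apply, add_apply, h1]; simp
    rw [h2, ih]
    rw [pp_apply]
    exact (hx.smul _).add ((g.suppN x).smul _)

lemma VS.vbound (he : Orthonormal ℂ e) (hc : N + 3 < c)
    (S : VS e N A lam b c h K μ v A') {G : ℝ} (hG : 1 ≤ G)
    (h0 : ∀ s ≤ N, ‖(A ^ s) (e 0)‖ ≤ G) (hK : ‖(K (N+1))⁻¹‖ ≤ 1)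
    (hμ : ∀ s, ‖(μ s)⁻¹‖ ≤ 1) (r : ℕ) (hr : r ≤ h) (s : ℕ) (hs : s ≤ N + 1) :
    ‖v (r * c + s)‖ ≤ G * (2 + ‖b‖) ^ r := by
  have h1b : 1 ≤ 2 + ‖b‖ := by linarith [norm_nonneg b]
  have hgap : ∀ r ≤ h, ‖v (r * c + (N+1))‖ ≤ G * (2 + ‖b‖) ^ r := fun r hr => by
    have h4 : r * c ≤ h * c := Nat.mul_le_mul_right c hr
    rw [S.gap r (N+1) (by omega) (by omega) (by omega), norm_smul, he.1, mul_one]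
    refine hK.trans ?_
    have : 1 ≤ (2 + ‖b‖) ^ r := one_le_pow₀ h1b
    nlinarith
  induction r generalizing s with
  | zero =>
    rcases Nat.lt_or_ge N s with h1 | h1
    · obtain rfl : s = N + 1 := by omega
      exact hgap 0 hr
    · rw [zero_mul, zero_add, S.head s h1, pow_zero, mul_one]; exact h0 s h1
  | succ r ih =>
    rcases Nat.lt_or_ge N s with h1 | h1
    · obtain rfl : s = N + 1 := by omega
      exact hgap (r+1) hr
    · rw [S.fan r s (by omega) h1]
      have a1 := ih (by omega) s hs
      have a2 := ih (by omega) (s+1) (by omega)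
      rw [← add_assoc] at a2
      have a3 : ‖(μ s)⁻¹ • e ((r + 1) * c + s)‖ ≤ 1 := by
        rw [norm_smul, he.1, mul_one]; exact hμ s
      refine norm_add₃_le.trans ?_
      rw [norm_smul (1/2 : ℂ), norm_smul b]
      have h5 : ‖(1/2 : ℂ)‖ = 1/2 := by norm_num
      have : 1 ≤ G * (2 + ‖b‖) ^ r := by
        have : 1 ≤ (2 + ‖b‖) ^ r := one_le_pow₀ h1b
        nlinarith
      have a4 := mul_le_mul_of_nonneg_left a2 (norm_nonneg b)
      rw [h5, pow_succ]
      nlinarith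

/-- everything once the parameters are quantitatively good -/
lemma VS.final (he : Orthonormal ℂ e)
    (hd : (Submodule.span ℂ (Set.range e)).topologicalClosure = ⊤)
    (g : Good e N A cons) (hc : N + 3 < c) (hh : 1 ≤ h)
    (hlam : lam ≠ 0) (htop : (A ^ N) (e 0) = lam • e N)
    (hK : ∀ s, K s ≠ 0) (hμ : ∀ s, μ s ≠ 0) {w δ : ℂ} (hb : ‖b‖ * ‖δ‖ ≤ 1/4)
    (hδw : ‖δ‖ ≤ ‖w‖) (hw2 : ‖w‖ ≤ 2)
    (hwa : ∀ p ∈ cons, ‖w‖ ^ p.1 ≤ 2)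
    (S : VS e N A lam b c h K μ v A') {ρ L L2 ε1 : ℝ} (hρ1 : ρ ≤ 1)
    (hR : ‖A' - (A + Wop e N c h w δ)‖ ≤ ρ)
    (hL : L = ‖A‖ + 3) (hL2 : L2 = 1 + ‖b‖ * L)
    (hcons : ∀ p ∈ cons, ∃ C : ℝ, 0 ≤ C ∧ C + p.1 * L ^ p.1 * ρ < 7 ∧
      ∀ x, Tail e p.2 x → ‖((A + Wop e N c h w δ) ^ p.1) x‖ ≤ C * ‖x‖)
    (hε1 : ε1 = (h + 1) * L2 ^ (h+1) * (‖b‖ * ρ)) (hε1' : h * ε1 ≤ 1)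
    (hZ1 : ∑ s ∈ range (N+1), ‖μ s‖ * ‖(pp b A ^ (h+1)) ((A ^ s) (e 0))‖ ≤ 1/2)
    (hZ2 : (∑ s ∈ range (N+1), ‖μ s‖ * ‖(A ^ s) (e 0)‖) * ε1 ≤ 1/2) :
    Good e (h * c + N + 1) A' ((c, N+1) :: cons) := by
  have hstep := S.step he hd g hc hlam htop hK hμ
  set B := A + Wop e N c h w δ with hB
  have hρ0 : 0 ≤ ρ := (norm_nonneg _).trans hR
  have hBL : ‖B‖ ≤ L := by
    have := norm_add_le A (Wop e N c h w δ)
    have h2 := Wop_norm he N c h hδw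
    linarith
  have hA'L : ‖A'‖ ≤ L := by
    have h1 : A' = (A' - B) + (A + Wop e N c h w δ) := by rw [← hB]; abel
    have h3 := norm_add_le (A' - B) (A + Wop e N c h w δ)
    rw [← h1] at h3
    have := norm_add_le A (Wop e N c h w δ)
    have h2 := Wop_norm he N c h hδw
    linarith
  have hL1 : 1 ≤ L := by linarith [norm_nonneg A]
  have hL21 : 1 ≤ L2 := by
    have : 0 ≤ ‖b‖ * L := by positivity
    linarith
  have hppn : ∀ X : H →L[ℂ] H, ‖X‖ ≤ L → ‖pp b X‖ ≤ L2 := fun X hX => by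
    have h1 := pp_norm b X
    have h2 := mul_le_mul_of_nonneg_left hX (norm_nonneg b)
    linarith
  have hppd : ‖pp b A' - pp b B‖ ≤ ‖b‖ * ρ := by
    have : pp b A' - pp b B = b • (A' - B) := by
      unfold pp; rw [smul_sub]; abel
    rw [this, norm_smul]
    exact mul_le_mul_of_nonneg_left hR (norm_nonneg b)
  have hpm : ∀ m ≤ h + 1, ‖pp b A' ^ m - pp b B ^ m‖ ≤ ε1 := fun m hm => by
    refine (pow_diff _ _ hL21 (hppn _ hA'L) (hppn _ hBL) m).trans ?_
    rw [hε1]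
    have hm' : (m : ℝ) ≤ h + 1 := by exact_mod_cast hm
    have := pow_le_pow_right₀ hL21 hm
    gcongr
  apply S.good he hd g hc hh hlam htop hK hμ
  intro p hp
  rcases List.mem_cons.mp hp with rfl | hp
  · have hch : c ≤ h * c := Nat.le_mul_of_pos_left c hh
    refine ⟨by simp; omega, by simp; omega, 6, by norm_num, by norm_num, ?_⟩
    refine S.tail_bound he hd g hc hh hK hμ hstep w δ hb hε1' (fun m hm => hpm m (by omega)) ?_
    have : ∀ s ∈ range (N+1), ‖μ s • (pp b A' ^ (h + 1)) (v s)‖ ≤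
        ‖μ s‖ * ‖(pp b A ^ (h+1)) ((A ^ s) (e 0))‖ + ‖μ s‖ * ‖(A ^ s) (e 0)‖ * ε1 := by
      intro s hs
      have hs' : s ≤ N := by simp at hs; omega
      rw [S.head s hs', norm_smul, mul_assoc, ← mul_add]
      refine mul_le_mul_of_nonneg_left ?_ (norm_nonneg _)
      have hsup : Supp e (N+1) ((A ^ s) (e 0)) :=
        (g.supp_pow he hd (supp_e he Nat.zero_lt_one) s).mono (by omega)
      rw [← pp_head he hd g w δ (h+1) _ hsup (c := c) (h := h)]
      have h6 : (pp b A' ^ (h+1)) ((A ^ s) (e 0)) = (pp b B ^ (h+1)) ((A ^ s) (e 0)) +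
          (pp b A' ^ (h+1) - pp b B ^ (h+1)) ((A ^ s) (e 0)) := by
        rw [sub_apply]; abel
      rw [h6]
      refine (norm_add_le _ _).trans (add_le_add le_rfl ?_)
      refine (ContinuousLinearMap.le_opNorm _ _).trans ?_
      rw [mul_comm]
      exact mul_le_mul_of_nonneg_left (hpm _ le_rfl) (norm_nonneg _)
    refine (sum_le_sum this).trans ?_
    rw [sum_add_distrib, ← sum_mul]
    linarith
  · obtain ⟨ha, hk, -⟩ := g.cons p hp
    obtain ⟨C, hC0, hC7, hCx⟩ := hcons p hp
    refine ⟨ha, by omega, C + p.1 * L ^ p.1 * ρ, by positivity, hC7, fun x hx => ?_⟩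
    have h6 : (A' ^ p.1) x = (B ^ p.1) x + (A' ^ p.1 - B ^ p.1) x := by
        rw [sub_apply]; abel
    rw [h6, add_mul]
    refine (norm_add_le _ _).trans (add_le_add (hCx x hx) ?_)
    refine (ContinuousLinearMap.le_opNorm _ _).trans ?_
    refine mul_le_mul_of_nonneg_right ?_ (norm_nonneg _)
    refine (pow_diff _ _ hL1 hA'L hBL p.1).trans ?_
    gcongr

lemma evsmall (a c : ℝ) (hc : 0 < c) : ∀ᶠ ρ : ℝ in nhdsWithin 0 (Set.Ioi 0), a * ρ < c := by
  have : Filter.Tendsto (fun ρ : ℝ => a * ρ) (nhdsWithin 0 (Set.Ioi 0)) (nhds 0) := by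
    have h : Filter.Tendsto (fun ρ : ℝ => a * ρ) (nhds 0) (nhds (a * 0)) :=
      (continuous_const.mul continuous_id).tendsto 0
    rw [mul_zero] at h
    exact h.mono_left nhdsWithin_le_nhds
  exact this.eventually_lt_const hc

theorem step (he : Orthonormal ℂ e)
    (hd : (Submodule.span ℂ (Set.range e)).topologicalClosure = ⊤)
    (g : Good e N A cons) (b : ℂ) {ε : ℝ} (hε : 0 < ε) :
    ∃ N' A' c, Good e N' A' ((c, N+1) :: cons) ∧ N + c < N' ∧ (∀ j < N, A' (e j) = A (e j)) ∧
      ‖A' (e N)‖ ≤ ε ∧ ∀ j ≤ N, ‖(A' ^ c) (e j) - (1/2 : ℂ) • e j - b • A' (e j)‖ ≤ ε := by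
  obtain ⟨lam, hlam, htop⟩ := g.top
  obtain ⟨Γ, hΓ0, hΓ⟩ := g.exists_Γ
  -- δ
  obtain ⟨δ, hδ0, hδ1, hδb⟩ : ∃ δ : ℝ, 0 < δ ∧ δ ≤ 1 ∧ ‖b‖ * δ ≤ 1/4 := by
    have hb := norm_nonneg b
    refine ⟨1 / (4 * (‖b‖ + 1)), by positivity, ?_, ?_⟩
    · rw [div_le_one (by positivity)]; linarith
    · rw [mul_one_div, div_le_div_iff₀ (by positivity) (by norm_num)]; linarith
  obtain ⟨M, hM1, hMΓ⟩ : ∃ M : ℝ, 1 ≤ M ∧ Γ * M⁻¹ ≤ ε := by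
    refine ⟨max 1 (Γ / ε), le_max_left _ _, ?_⟩
    rw [← div_eq_mul_inv, div_le_comm₀ (by positivity) hε]
    exact le_max_right _ _
  have hM0 : 0 < M := by linarith
  set μ : ℕ → ℂ := fun s => ((M / δ ^ s : ℝ) : ℂ) with hμd
  have hμn : ∀ s, ‖μ s‖ = M / δ ^ s := fun s => by
    rw [hμd]; simp only [Complex.norm_real, Real.norm_eq_abs]; exact abs_of_pos (by positivity)
  have hμ : ∀ s, μ s ≠ 0 := fun s => by
    rw [← norm_pos_iff, hμn]; positivity
  have hμM : ∀ s, ‖(μ s)⁻¹‖ ≤ M⁻¹ := fun s => by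
    rw [norm_inv, hμn, inv_div, div_eq_mul_inv]
    exact mul_le_of_le_one_left (by positivity) (pow_le_one₀ hδ0.le hδ1)
  have hM1' : M⁻¹ ≤ 1 := inv_le_one_of_one_le₀ hM1
  have hμδ : ∀ s, μ s = (δ : ℂ) * μ (s+1) := fun s => by
    rw [hμd]; simp only; norm_cast; rw [pow_succ]; field_simp
  -- h
  have hAN : ∀ s, (A ^ (N+1)) ((A ^ s) (e 0)) = 0 := fun s => by
    have h1 : (A ^ (N+1)) (e 0) = 0 := by
      rw [pow_succ']; change A ((A ^ N) (e 0)) = 0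
      rw [htop, map_smul, g.last, smul_zero]
    change (A ^ (N+1) * A ^ s) (e 0) = 0
    rw [← pow_add, add_comm, pow_add]
    change (A ^ s) ((A ^ (N+1)) (e 0)) = 0
    rw [h1, map_zero]
  choose Cs hCs0 hCs using fun s => pp_decay b A (N+1) _ (hAN s)
  obtain ⟨h, hh, hZ1⟩ : ∃ h : ℕ, 1 ≤ h ∧
      ∑ s ∈ range (N+1), ‖μ s‖ * ‖(pp b A ^ (h+1)) ((A ^ s) (e 0))‖ ≤ 1/2 := by
    set Ct := ∑ s ∈ range (N+1), ‖μ s‖ * Cs s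
    have ht : Filter.Tendsto (fun n : ℕ => Ct * (3/4 : ℝ)^(n+1)) Filter.atTop (nhds (Ct * 0)) :=
      ((tendsto_pow_atTop_nhds_zero_of_lt_one (by norm_num) (by norm_num)).comp
        (Filter.tendsto_add_atTop_nat 1)).const_mul Ct
    rw [mul_zero] at ht
    obtain ⟨h, h1, h2⟩ := ((ht.eventually_lt_const (u := 1/2) (by norm_num)).and
      (Filter.eventually_ge_atTop 1)).exists
    refine ⟨h, h2, le_trans ?_ h1.le⟩
    rw [sum_mul]
    refine sum_le_sum fun s _ => ?_
    rw [mul_assoc]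
    exact mul_le_mul_of_nonneg_left (hCs s _) (norm_nonneg _)
  -- w
  obtain ⟨w, hw1, hw2, hwa⟩ : ∃ w : ℝ, 1 < w ∧ w ≤ 2 ∧ ∀ p ∈ cons, w ^ p.1 ≤ 2 := by
    obtain ⟨a0, ha0⟩ : ∃ a0 : ℕ, ∀ p ∈ cons, p.1 ≤ a0 := by
      refine ⟨(cons.map Prod.fst).sum, fun p hp => ?_⟩
      exact List.single_le_sum (by simp) _ (List.mem_map_of_mem hp)
    have hw : (1:ℝ) < 2 ^ (((a0 + 1 : ℕ) : ℝ)⁻¹) := Real.one_lt_rpow (by norm_num) (by positivity)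
    have hwp : ((2:ℝ) ^ (((a0 + 1 : ℕ) : ℝ)⁻¹)) ^ (a0 + 1) = 2 :=
      Real.rpow_inv_natCast_pow (by norm_num) (by omega)
    refine ⟨2 ^ (((a0 + 1 : ℕ) : ℝ)⁻¹), hw, ?_, fun p hp => ?_⟩
    · calc _ = ((2:ℝ) ^ (((a0 + 1 : ℕ) : ℝ)⁻¹)) ^ 1 := (pow_one _).symm
        _ ≤ ((2:ℝ) ^ (((a0 + 1 : ℕ) : ℝ)⁻¹)) ^ (a0+1) := pow_le_pow_right₀ hw.le (by omega)
        _ = 2 := hwp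
    · refine le_trans (pow_le_pow_right₀ hw.le ?_) hwp.le
      have := ha0 p hp
      omega
  have hwn : ‖(w:ℂ)‖ = w := by
    rw [Complex.norm_real, Real.norm_eq_abs, abs_of_pos (by linarith)]
  have hδn : ‖(δ:ℂ)‖ = δ := by
    rw [Complex.norm_real, Real.norm_eq_abs, abs_of_pos (by linarith)]
  have hδw : ‖(δ:ℂ)‖ ≤ ‖(w:ℂ)‖ := by rw [hwn, hδn]; linarith
  -- constants
  choose! C hC using fun p (hp : p ∈ cons) => (g.cons p hp).2.2
  have ha1 := fun p (hp : p ∈ cons) => (g.cons p hp).1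
  set L := ‖A‖ + 3 with hL
  set L2 := 1 + ‖b‖ * L with hL2
  set Z2 := ∑ s ∈ range (N+1), ‖μ s‖ * ‖(A ^ s) (e 0)‖ with hZ2
  set E := ((h:ℝ) + 1) * L2 ^ (h+1) * ‖b‖ with hE
  obtain ⟨ρ, hρ0, hρ1, hρε, hρh, hρZ, hρc⟩ : ∃ ρ : ℝ, 0 < ρ ∧ ρ < 1 ∧ ρ < ε ∧ (h * E) * ρ < 1 ∧
      (Z2 * E) * ρ < 1/2 ∧ ∀ p ∈ cons, (p.1 * L ^ p.1) * ρ < 7 - max (C p) 2 := by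
    have h1 := evsmall 1 1 one_pos
    have h2 := evsmall 1 ε hε
    have h3 := evsmall (h * E) 1 one_pos
    have h4 := evsmall (Z2 * E) (1/2) (by norm_num)
    have h5 : ∀ᶠ ρ : ℝ in nhdsWithin 0 (Set.Ioi 0), ∀ p ∈ {p | p ∈ cons},
        (p.1 * L ^ p.1) * ρ < 7 - max (C p) 2 := by
      rw [Filter.eventually_all_finite (List.finite_toSet cons)]
      intro p hp
      refine evsmall _ _ ?_
      have := (hC p hp).2.1
      rw [sub_pos, max_lt_iff]
      exact ⟨this, by norm_num⟩
    have h0 : ∀ᶠ ρ : ℝ in nhdsWithin 0 (Set.Ioi 0), 0 < ρ := self_mem_nhdsWithin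
    obtain ⟨ρ, a0, a1, a2, a3, a4, a5⟩ :=
      (h0.and (h1.and (h2.and (h3.and (h4.and h5))))).exists
    exact ⟨ρ, a0, by linarith, by linarith, a3, a4, a5⟩
  set η := ρ / (2 * h + 1) with hη
  have hη0 : 0 < η := by positivity
  have hηρ : η ≤ ρ := div_le_self hρ0.le (by linarith [(Nat.cast_nonneg h : (0:ℝ) ≤ h)])
  obtain ⟨κ, hκ0, hκ1, hκl, hκμ⟩ : ∃ κ : ℝ, 0 < κ ∧ κ < 1 ∧ ‖lam⁻¹‖ * κ < η ∧
      (‖μ N‖ * (3/2 + ‖b‖)) * κ < η := by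
    have h0 : ∀ᶠ ρ : ℝ in nhdsWithin 0 (Set.Ioi 0), 0 < ρ := self_mem_nhdsWithin
    obtain ⟨ρ, a0, a1, a2, a3⟩ := (h0.and ((evsmall 1 1 one_pos).and ((evsmall ‖lam⁻¹‖ η hη0).and
      (evsmall (‖μ N‖ * (3/2 + ‖b‖)) η hη0)))).exists
    exact ⟨ρ, a0, by linarith, a2, a3⟩
  have hw0 : 0 < w := by linarith
  set Θ := w ^ (N+2) / κ with hΘ
  have hΘ0 : 0 < Θ := by positivity
  set K : ℕ → ℂ := fun s => ((Θ / w ^ s : ℝ) : ℂ) with hKd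
  have hKn : ∀ s, ‖K s‖ = Θ / w ^ s := fun s => by
    rw [hKd]; simp only [Complex.norm_real, Real.norm_eq_abs]; exact abs_of_pos (by positivity)
  have hK : ∀ s, K s ≠ 0 := fun s => by
    rw [← norm_pos_iff, hKn]; positivity
  have hKw : ∀ s, K s = (w : ℂ) * K (s+1) := fun s => by
    rw [hKd]; simp only; norm_cast; rw [pow_succ]; field_simp
  have hK1 : ∀ s ≤ N + 2, ‖(K s)⁻¹‖ ≤ κ := fun s hs => by
    rw [norm_inv, hKn, inv_div, hΘ, div_div_eq_mul_div, div_le_iff₀ (by positivity), mul_comm]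
    exact mul_le_mul_of_nonneg_left (pow_le_pow_right₀ hw1.le hs) hκ0.le
  set G := 1 + ∑ s ∈ range (N+1), ‖(A ^ s) (e 0)‖ with hG
  have hG1 : 1 ≤ G := by
    have : 0 ≤ ∑ s ∈ range (N+1), ‖(A ^ s) (e 0)‖ := sum_nonneg fun _ _ => norm_nonneg _
    linarith
  have hGs : ∀ s ≤ N, ‖(A ^ s) (e 0)‖ ≤ G := fun s hs => by
    have := single_le_sum (f := fun s => ‖(A ^ s) (e 0)‖) (s := range (N+1))
      (fun _ _ => norm_nonneg _) (mem_range.mpr (show s < N + 1 by omega))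
    linarith
  set G2 := G * (2 + ‖b‖) ^ h with hG2
  obtain ⟨c, hc, hcG⟩ : ∃ c : ℕ, N + 3 < c ∧ Θ / w ^ (c - 1) * G2 ≤ η := by
    have ht : Filter.Tendsto (fun n : ℕ => (Θ * G2) * (w⁻¹)^n) Filter.atTop
        (nhds ((Θ * G2) * 0)) :=
      (tendsto_pow_atTop_nhds_zero_of_lt_one (by positivity)
        (inv_lt_one_of_one_lt₀ hw1)).const_mul _
    rw [mul_zero] at ht
    obtain ⟨n, h1, h2⟩ := ((ht.eventually_lt_const hη0).and
      (Filter.eventually_gt_atTop (N+3))).exists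
    refine ⟨n + 1, by omega, ?_⟩
    rw [Nat.add_sub_cancel]
    refine le_trans (le_of_eq ?_) h1.le
    rw [inv_pow]; field_simp
  obtain ⟨v, A', S⟩ := exists_VS he N A lam b c h hc hh K μ
  have hstep := S.step he hd g hc hlam htop hK hμ
  have hch : c ≤ h * c := Nat.le_mul_of_pos_left c hh
  have hvb := S.vbound he hc hG1 hGs ((hK1 (N+1) (by omega)).trans hκ1.le)
    (fun s => (hμM s).trans hM1')
  have hvN : ∀ r ≤ h, ‖v (r * c + N + 1)‖ ≤ κ := fun r hr => by
    have h4 : r * c ≤ h * c := Nat.mul_le_mul_right c hr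
    rw [add_assoc, S.gap r (N+1) (by omega) (by omega) (by omega), norm_smul, he.1, mul_one]
    exact hK1 _ (by omega)
  have hvN2 : ∀ r < h, ‖v (r * c + N + 2)‖ ≤ κ := fun r hr => by
    have h4 : (r + 1) * c ≤ h * c := Nat.mul_le_mul_right c hr
    have h2 : (r + 1) * c = r * c + c := by ring
    rw [add_assoc, S.gap r (N+2) (by omega) (by omega) (by omega), norm_smul, he.1, mul_one]
    exact hK1 _ (by omega)
  have r1 : ‖lam⁻¹ • v (N + 1)‖ ≤ η := by
    have := hvN 0 (by omega)
    rw [zero_mul, zero_add] at this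
    rw [norm_smul]
    exact (mul_le_mul_of_nonneg_left this (norm_nonneg _)).trans hκl.le
  have hR : ‖A' - (A + Wop e N c h w δ)‖ ≤ ρ := by
    have := S.R_norm he hd g hc hh hK hμ hKw hμδ (η := η) r1 ?_ ?_
    · refine this.trans (le_of_eq ?_)
      rw [hη]; field_simp
    · intro r hr
      rw [norm_smul, hKn]
      refine le_trans (mul_le_mul_of_nonneg_left ?_ (by positivity)) hcG
      have h1 := hvb (r+1) hr 0 (by omega)
      rw [add_zero] at h1
      refine h1.trans ?_
      rw [hG2]
      refine mul_le_mul_of_nonneg_left (pow_le_pow_right₀ ?_ hr) (by linarith)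
      linarith [norm_nonneg b]
    · intro r hr
      have a1 := hvN (r+1) hr
      have a2 := hvN r hr.le
      have a3 := hvN2 r hr
      rw [norm_smul]
      refine le_trans ?_ hκμ.le
      rw [mul_assoc]
      refine mul_le_mul_of_nonneg_left ?_ (norm_nonneg _)
      refine (norm_sub_le _ _).trans ?_
      refine (add_le_add (norm_sub_le _ _) le_rfl).trans ?_
      rw [norm_smul, norm_smul]
      have h5 : ‖(1/2 : ℂ)‖ = 1/2 := by norm_num
      have a4 := mul_le_mul_of_nonneg_left a3 (norm_nonneg b)
      rw [h5]
      linarith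
  refine ⟨h * c + N + 1, A', c, ?_, by omega, S.a1, ?_, ?_⟩
  · refine S.final he hd g hc hh hlam htop hK hμ (w := w) (δ := δ) (by rw [hδn]; exact hδb) hδw
      (by rw [hwn]; exact hw2) (by rw [hwn]; exact hwa) (ρ := ρ) (ε1 := E * ρ) hρ1.le hR hL hL2
      ?_ (by rw [hE]; ring) (by rw [← mul_assoc]; exact hρh.le) hZ1
      (by rw [← mul_assoc]; exact hρZ.le)
    intro p hp
    refine ⟨max (C p) 2, le_max_of_le_right (by norm_num), ?_, ?_⟩
    · have := hρc p hp
      linarith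
    · exact B_bound he hd g hδw (by rw [hwn]; exact hwa p hp) (ha1 p hp) (hC p hp).1 (hC p hp).2.2
  · rw [S.a2]; exact r1.trans (hηρ.trans hρε.le)
  · intro j hj
    have := hΓ (A' ^ c - pp b A') M⁻¹ (by positivity) ?_ j hj
    · rw [sub_apply, pp_apply] at this
      rw [sub_sub]
      exact this.trans hMΓ
    · intro i hi
      have h1 := S.fan 0 i (by omega) hi
      rw [zero_add, one_mul, zero_mul, zero_add, add_comm c i] at h1
      rw [← S.head i hi, sub_apply, pp_apply, pow_step hstep, h1, hstep, add_sub_cancel_left,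
        norm_smul, he.1, mul_one]
      exact hμM i
end partF

section partJ
open Finset
variable {H : Type} [NormedAddCommGroup H] [InnerProductSpace ℂ H]
section abstractPart
open Polynomial

def EO (T : H →L[ℂ] H) (x : H) : Set H := closure (Set.range fun n : ℕ => (T ^ n) x)

def MO (T : H →L[ℂ] H) (x : H) : Submodule ℂ H :=
  (Submodule.span ℂ (Set.range fun n : ℕ => (T ^ n) x)).topologicalClosure

lemma mem_EO (T : H →L[ℂ] H) (x : H) (n : ℕ) : (T ^ n) x ∈ EO T x :=
  subset_closure ⟨n, rfl⟩

lemma EO_sub (T : H →L[ℂ] H) {x y : H} (hy : y ∈ EO T x) : EO T y ⊆ EO T x := by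
  refine closure_minimal ?_ isClosed_closure
  rintro _ ⟨n, rfl⟩
  refine map_mem_closure (T ^ n).continuous hy ?_
  rintro _ ⟨k, rfl⟩
  refine ⟨n + k, ?_⟩
  simp only [pow_add]; rfl

lemma aeval_mul_apply (T : H →L[ℂ] H) (p q : ℂ[X]) (x : H) :
    aeval T (p * q) x = aeval T p (aeval T q x) := by
  rw [map_mul]; rfl

lemma poly_mem (T : H →L[ℂ] H) (hA : ∀ x (β : ℂ), (1/2 : ℂ) • x + β • T x ∈ EO T x) (m : ℕ) :
    ∀ (f : ℂ[X]) (x : H), f.coeff 0 = (1/2)^m → f.natDegree ≤ m → aeval T f x ∈ EO T x := by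
  induction m with
  | zero =>
    intro f x h0 hdeg
    have h1 : f = C 1 := by
      rw [eq_C_of_natDegree_le_zero hdeg, h0]; simp
    rw [h1]
    simpa using mem_EO T x 0
  | succ m ih =>
    intro f x h0 hdeg
    have key : ∃ (β : ℂ) (g : ℂ[X]), f = (C (1/2) + C β * X) * g ∧ g.coeff 0 = (1/2)^m ∧
        g.natDegree ≤ m := by
      by_cases hd : f.natDegree = 0
      · refine ⟨0, C ((1/2)^m), ?_, by simp, by simp⟩
        rw [eq_C_of_natDegree_eq_zero hd, h0, C_0, zero_mul, add_zero, ← C_mul, pow_succ']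
      · have hf0 : f ≠ 0 := by rintro rfl; simp at hd
        obtain ⟨r, hr⟩ := IsAlgClosed.exists_root f (by
          intro h; rw [degree_eq_natDegree hf0] at h; exact hd (by exact_mod_cast h))
        have hr0 : r ≠ 0 := by
          rintro rfl
          rw [IsRoot, ← coeff_zero_eq_eval_zero, h0] at hr
          exact absurd hr (pow_ne_zero _ (by norm_num))
        obtain ⟨g, hg⟩ := dvd_iff_isRoot.mpr hr
        have hg0 : g ≠ 0 := by rintro rfl; exact hf0 (by rw [hg, mul_zero])
        have hdg : f.natDegree = 1 + g.natDegree := by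
          rw [hg, natDegree_mul (X_sub_C_ne_zero r) hg0, natDegree_X_sub_C]
        have hc0 : f.coeff 0 = -r * g.coeff 0 := by
          rw [hg, mul_coeff_zero]; simp
        refine ⟨-(1/(2*r)), C (-2 * r) * g, ?_, ?_, ?_⟩
        · have : (C (1/2) + C (-(1/(2*r))) * X) * C (-2 * r) = X - C r := by
            rw [add_mul, ← C_mul, mul_right_comm, ← C_mul]
            have h1 : (1/2 : ℂ) * (-2 * r) = -r := by ring
            have h2 : -(1/(2*r)) * (-2 * r) = 1 := by field_simp
            rw [h1, h2, C_1, one_mul, C_neg]; ring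
          rw [← mul_assoc, this, hg]
        · rw [coeff_C_mul]
          have : -2 * r * g.coeff 0 = 2 * f.coeff 0 := by rw [hc0]; ring
          rw [this, h0, pow_succ]; ring
        · refine (natDegree_C_mul_le _ _).trans (by omega)
    obtain ⟨β, g, rfl, hg0, hgd⟩ := key
    rw [aeval_mul_apply]
    have h1 := ih g x hg0 hgd
    refine EO_sub T h1 ?_
    have := hA (aeval T g x) β
    convert this using 1
    simp [Algebra.algebraMap_eq_smul_one]

/-- `g ↦ (X g)(T) x` -/
noncomputable def LX (T : H →L[ℂ] H) (x : H) : ℂ[X] →ₗ[ℂ] H where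
  toFun g := aeval T (X * g) x
  map_add' p q := by rw [mul_add, map_add]; rfl
  map_smul' a p := by rw [mul_smul_comm, map_smul]; rfl

lemma LX_mem (T : H →L[ℂ] H) (hA : ∀ x (β : ℂ), (1/2 : ℂ) • x + β • T x ∈ EO T x) (x : H)
    (g : ℂ[X]) : LX T x g ∈ EO T x := by
  have hlim : Filter.Tendsto (fun m : ℕ => ((1/2 : ℂ)^m) • x + LX T x g) Filter.atTop
      (nhds ((0:ℂ) • x + LX T x g)) := by
    refine Filter.Tendsto.add_const _ (Filter.Tendsto.smul_const ?_ _)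
    exact tendsto_pow_atTop_nhds_zero_of_norm_lt_one (by norm_num)
  rw [zero_smul, zero_add] at hlim
  refine isClosed_closure.mem_of_tendsto hlim ?_
  filter_upwards [Filter.eventually_ge_atTop (g.natDegree + 1)] with m hm
  have := poly_mem T hA m (C ((1/2)^m) + X * g) x (by simp) ?_
  · rw [map_add, aeval_C, Algebra.algebraMap_eq_smul_one] at this
    exact this
  · refine (natDegree_add_le _ _).trans ?_
    rw [natDegree_C]
    have := natDegree_mul_le (p := (X : ℂ[X])) (q := g)
    rw [natDegree_X] at this
    simp; omega

noncomputable def VO (T : H →L[ℂ] H) (x : H) : Submodule ℂ H := (LinearMap.range (LX T x)).topologicalClosure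

lemma VO_sub (T : H →L[ℂ] H) (hA : ∀ x (β : ℂ), (1/2 : ℂ) • x + β • T x ∈ EO T x) (x : H) :
    (VO T x : Set H) ⊆ EO T x := by
  refine closure_minimal ?_ isClosed_closure
  rintro _ ⟨g, rfl⟩
  exact LX_mem T hA x g

lemma pow_mem_VO (T : H →L[ℂ] H) (x : H) (k : ℕ) : (T ^ (k+1)) x ∈ VO T x := by
  refine subset_closure ⟨X ^ k, ?_⟩
  simp only [LX, LinearMap.coe_mk, AddHom.coe_mk]
  rw [← pow_succ', map_pow, aeval_X]

lemma self_mem_VO (T : H →L[ℂ] H) (hA : ∀ x (β : ℂ), (1/2 : ℂ) • x + β • T x ∈ EO T x) (x : H) :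
    x ∈ VO T x := by
  by_cases hx : x = 0
  · subst hx; exact zero_mem _
  have h1 := hA x 0
  rw [zero_smul, add_zero] at h1
  have h2 : (Set.range fun n : ℕ => (T ^ n) x) ⊆ {x} ∪ (VO T x : Set H) := by
    rintro _ ⟨n, rfl⟩
    cases n with
    | zero => left; simp
    | succ n => right; exact pow_mem_VO T x n
  have h3 : IsClosed ({x} ∪ (VO T x : Set H)) :=
    isClosed_singleton.union (Submodule.isClosed_topologicalClosure _)
  have h4 := closure_minimal h2 h3 h1
  rcases h4 with h4 | h4
  · exfalso
    have h5 : (1/2 : ℂ) • x = x := h4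
    have h6 : (1/2 : ℂ) • x = 0 := by
      have : x - (1/2 : ℂ) • x = (1/2 : ℂ) • x := by
        rw [← one_smul ℂ x, smul_smul, ← sub_smul]; norm_num
      rw [← this, h5, sub_self]
    rw [h6] at h5
    exact hx h5.symm
  · have := (VO T x).smul_mem 2 h4
    rw [smul_smul] at this
    norm_num at this
    exact this

lemma MO_le_VO (T : H →L[ℂ] H) (hA : ∀ x (β : ℂ), (1/2 : ℂ) • x + β • T x ∈ EO T x) (x : H) :
    MO T x ≤ VO T x := by
  refine Submodule.topologicalClosure_minimal _ ?_ (Submodule.isClosed_topologicalClosure _)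
  rw [Submodule.span_le]
  rintro _ ⟨n, rfl⟩
  cases n with
  | zero => simpa using self_mem_VO T hA x
  | succ n => exact pow_mem_VO T x n

lemma EO_eq (T : H →L[ℂ] H) (hA : ∀ x (β : ℂ), (1/2 : ℂ) • x + β • T x ∈ EO T x) (x : H) :
    EO T x = MO T x := by
  apply Set.Subset.antisymm
  · exact closure_mono Submodule.subset_span
  · exact fun y hy => VO_sub T hA x (MO_le_VO T hA x hy)

lemma MO_inv (T : H →L[ℂ] H) (x : H) {y : H} (hy : y ∈ MO T x) : T y ∈ MO T x := by
  refine map_mem_closure T.continuous hy ?_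
  intro z hz
  induction hz using Submodule.span_induction with
  | mem z h =>
    obtain ⟨n, rfl⟩ := h
    refine Submodule.subset_span ⟨n + 1, ?_⟩
    simp only [pow_succ']; rfl
  | zero => simp
  | add a b _ _ ha hb => rw [map_add]; exact add_mem ha hb
  | smul a z _ h => rw [map_smul]; exact Submodule.smul_mem _ _ h

lemma aeval_mem (T : H →L[ℂ] H) (M : Submodule ℂ H) (hM : ∀ y ∈ M, T y ∈ M) (q : ℂ[X]) {y : H}
    (hy : y ∈ M) : aeval T q y ∈ M := by
  induction q using Polynomial.induction_on' with
  | add p q hp hq => rw [map_add]; exact add_mem hp hq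
  | monomial n a =>
    rw [aeval_monomial, Algebra.algebraMap_eq_smul_one, smul_mul_assoc, one_mul]
    refine M.smul_mem a ?_
    induction n with
    | zero => simpa using hy
    | succ n ih => rw [pow_succ']; exact hM _ ih

lemma MO_le_of (T : H →L[ℂ] H) (hA : ∀ x (β : ℂ), (1/2 : ℂ) • x + β • T x ∈ EO T x) {x y : H}
    (h : T y ∈ MO T x) : MO T y ≤ MO T x := by
  refine (MO_le_VO T hA y).trans ?_
  refine Submodule.topologicalClosure_minimal _ ?_ (Submodule.isClosed_topologicalClosure _)
  rintro _ ⟨g, rfl⟩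
  change aeval T (X * g) y ∈ _
  rw [mul_comm, aeval_mul_apply, aeval_X]
  exact aeval_mem T _ (fun _ hy => MO_inv T x hy) g h

theorem abstract_final [CompleteSpace H] [TopologicalSpace.SeparableSpace H] (T : H →L[ℂ] H)
    (hA : ∀ x (β : ℂ), (1/2 : ℂ) • x + β • T x ∈ EO T x)
    (hB : ∀ x y, T y ∈ MO T x ∨ T x ∈ MO T y) :
    (∀ x : H, closure (Set.range fun n : ℕ => (T ^ n) x) =
        closure (Submodule.span ℂ (Set.range fun n : ℕ => (T ^ n) x) : Set H)) ∧
      (∀ x y : H,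
        closure (Set.range fun n : ℕ => (T ^ n) x) ⊆
          closure (Set.range fun n : ℕ => (T ^ n) y) ∨
        closure (Set.range fun n : ℕ => (T ^ n) y) ⊆
          closure (Set.range fun n : ℕ => (T ^ n) x)) ∧
      (∀ M : Submodule ℂ H, IsClosed (M : Set H) → (∀ x ∈ M, T x ∈ M) →
        ∃ x ∈ M, closure (Set.range fun n : ℕ => (T ^ n) x) = M) := by
  have hE := EO_eq T hA
  have h2 : ∀ x y, MO T x ≤ MO T y ∨ MO T y ≤ MO T x := fun x y => by
    rcases hB x y with h | h
    · right; exact MO_le_of T hA h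
    · left; exact MO_le_of T hA h
  refine ⟨fun x => hE x, fun x y => ?_, fun M hM hT => ?_⟩
  · change EO T x ⊆ EO T y ∨ EO T y ⊆ EO T x
    rw [hE x, hE y]
    exact h2 x y
  · by_contra hcon
    push Not at hcon
    have hle : ∀ x ∈ M, MO T x ≤ M := fun x hx => by
      refine Submodule.topologicalClosure_minimal _ ?_ hM
      rw [Submodule.span_le]
      rintro _ ⟨n, rfl⟩
      induction n with
      | zero => simpa using hx
      | succ n ih => simp only [pow_succ']; exact hT _ ih
    have hne : ∀ x ∈ M, MO T x ≠ M := fun x hx h => hcon x hx (by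
      change EO T x = M
      rw [hE x, h])
    have : CompleteSpace M := hM.completeSpace_coe
    have : SecondCountableTopology H := UniformSpace.secondCountable_of_separable H
    let u := TopologicalSpace.denseSeq M
    have hmem : ∀ (y : H), y ∈ MO T y := fun y =>
      subset_closure (Submodule.subset_span ⟨0, by simp⟩)
    have hcov : ⋃ n, {x : M | (x : H) ∈ MO T (u n)} = Set.univ := by
      rw [Set.eq_univ_iff_forall]
      intro x
      rw [Set.mem_iUnion]
      by_contra hx
      push Not at hx
      apply hne x x.2
      refine le_antisymm (hle x x.2) fun y hy => ?_
      have hcl : IsClosed {z : M | (z : H) ∈ MO T x} :=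
        (Submodule.isClosed_topologicalClosure _).preimage continuous_subtype_val
      have : Dense {z : M | (z : H) ∈ MO T x} := by
        refine (TopologicalSpace.denseRange_denseSeq M).mono ?_
        rintro _ ⟨n, rfl⟩
        rcases h2 x (u n) with h | h
        · exact absurd (h (hmem x)) (hx n)
        · exact h (hmem _)
      have h3 := hcl.closure_eq.symm.trans this.closure_eq
      exact (h3 ▸ Set.mem_univ (⟨y, hy⟩ : M) : (⟨y, hy⟩ : M) ∈ {z : M | (z : H) ∈ MO T x})
    obtain ⟨n, hn⟩ := nonempty_interior_of_iUnion_of_closed (fun n =>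
      (Submodule.isClosed_topologicalClosure _).preimage continuous_subtype_val) hcov
    apply hne (u n) (u n).2
    refine le_antisymm (hle _ (u n).2) ?_
    have h4 := Submodule.eq_top_of_nonempty_interior' ((MO T (u n)).comap M.subtype) hn
    intro y hy
    have : (⟨y, hy⟩ : M) ∈ (MO T (u n)).comap M.subtype := by rw [h4]; trivial
    exact this
end abstractPart
end partJ

section partG
open Finset
variable {H : Type} [NormedAddCommGroup H] [InnerProductSpace ℂ H]
variable {e : ℕ → H} {N : ℕ} {A : H →L[ℂ] H} {cons : List (ℕ × ℕ)} {lam b : ℂ} {c h : ℕ}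
  {K μ : ℕ → ℂ} {v : ℕ → H} {A' : H →L[ℂ] H}
section compactPart
open Polynomial

lemma Good.nil (g : Good e N A cons) (f : ℂ[X]) : aeval A (f * X ^ (N+1)) (e 0) = 0 := by
  obtain ⟨lam, -, htop⟩ := g.top
  rw [aeval_mul_apply, map_pow, aeval_X, pow_succ']
  change aeval A f (A ((A ^ N) (e 0))) = 0
  rw [htop, map_smul, g.last, smul_zero, map_zero]

lemma Good.exists_poly (he : Orthonormal ℂ e)
    (hd : (Submodule.span ℂ (Set.range e)).topologicalClosure = ⊤) (g : Good e N A cons)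
    {x : H} (hx : Supp e (N+1) x) : ∃ f : ℂ[X], aeval A f (e 0) = x := by
  have h1 : x ∈ Submodule.span ℂ ((fun i => (A ^ i) (e 0)) '' Set.Iic N) := by
    rw [← hx.eq he hd, Pr_apply]
    refine Submodule.sum_mem _ fun j hj => Submodule.smul_mem _ _ (g.cyc j ?_)
    simp at hj; omega
  clear hx
  induction h1 using Submodule.span_induction with
  | mem x h =>
    obtain ⟨i, hi, rfl⟩ := h
    exact ⟨X ^ i, by simp⟩
  | zero => exact ⟨0, by simp⟩
  | add x y _ _ hx hy =>
    obtain ⟨f, rfl⟩ := hx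
    obtain ⟨f', rfl⟩ := hy
    exact ⟨f + f', by simp⟩
  | smul z x _ hx =>
    obtain ⟨f, rfl⟩ := hx
    exact ⟨z • f, by simp⟩

lemma chain_poly (f g : ℂ[X]) (n : ℕ) : ∃ q w : ℂ[X], q * f = g + w * X ^ n ∨ q * g = f + w * X ^ n := by
  have main : ∀ (f1 g1 : ℂ[X]) (k l : ℕ), k ≤ l → ¬ (X ∣ f1) →
      ∃ q w : ℂ[X], q * (X ^ k * f1) = X ^ l * g1 + w * X ^ n := by
    intro f1 g1 k l hkl hf
    have h1 : IsCoprime (X ^ n) f1 := (irreducible_X.coprime_iff_not_dvd.mpr hf).pow_left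
    obtain ⟨a, u, hau⟩ := h1
    obtain ⟨m, rfl⟩ := Nat.exists_eq_add_of_le hkl
    refine ⟨X ^ m * g1 * u, - (X ^ (k + m) * g1 * a), ?_⟩
    have : u * f1 = 1 - a * X ^ n := by rw [← hau]; ring
    calc _ = X ^ (k + m) * g1 * (u * f1) := by ring
      _ = _ := by rw [this]; ring
  by_cases hf : f = 0
  · exact ⟨0, 0, Or.inr (by simp [hf])⟩
  by_cases hg : g = 0
  · exact ⟨0, 0, Or.inl (by simp [hg])⟩
  obtain ⟨f1, hf1, hf2⟩ := exists_eq_pow_rootMultiplicity_mul_and_not_dvd f hf 0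
  obtain ⟨g1, hg1, hg2⟩ := exists_eq_pow_rootMultiplicity_mul_and_not_dvd g hg 0
  rw [C_0, sub_zero] at hf1 hf2 hg1 hg2
  generalize rootMultiplicity 0 f = k at hf1
  generalize rootMultiplicity 0 g = l at hg1
  rcases le_total k l with hkl | hkl
  · obtain ⟨q, w, h⟩ := main f1 g1 k l hkl hf2
    exact ⟨q, w, Or.inl (by rw [hf1, hg1, h])⟩
  · obtain ⟨q, w, h⟩ := main g1 f1 l k hkl hg2
    exact ⟨q, w, Or.inr (by rw [hf1, hg1, h])⟩

lemma Good.chain (he : Orthonormal ℂ e)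
    (hd : (Submodule.span ℂ (Set.range e)).topologicalClosure = ⊤) (g : Good e N A cons)
    {x y : H} (hx : Supp e (N+1) x) (hy : Supp e (N+1) y) :
    ∃ q : ℂ[X], aeval A q x = y ∨ aeval A q y = x := by
  obtain ⟨f, rfl⟩ := g.exists_poly he hd hx
  obtain ⟨f', rfl⟩ := g.exists_poly he hd hy
  obtain ⟨q, w, h⟩ := chain_poly f f' (N+1)
  refine ⟨q, h.imp (fun h => ?_) (fun h => ?_)⟩
  · rw [← aeval_mul_apply, h, map_add, add_apply, g.nil, add_zero]
  · rw [← aeval_mul_apply, h, map_add, add_apply, g.nil, add_zero]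

noncomputable def wq (q : ℂ[X]) : ℝ := ∑ i ∈ range (q.natDegree + 1), ‖q.coeff i‖ * ((i + 1) * 7 ^ i)

lemma wq_nonneg (q : ℂ[X]) : 0 ≤ wq q := sum_nonneg fun _ _ => by positivity

lemma Good.compact (he : Orthonormal ℂ e)
    (hd : (Submodule.span ℂ (Set.range e)).topologicalClosure = ⊤) (g : Good e N A cons)
    (ρ : ℝ) {ε : ℝ} (hε : 0 < ε) : ∃ Λ : ℝ, 1 ≤ Λ ∧ ∀ x y, Supp e (N+1) x → Supp e (N+1) y →
      ‖x‖ ≤ ρ → ‖y‖ ≤ ρ → ∃ q : ℂ[X], wq q ≤ Λ ∧ (‖aeval A q x - y‖ < ε ∨ ‖aeval A q y - x‖ < ε) := by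
  let Φ : (Fin (N+1) → ℂ) → H := fun a => ∑ i : Fin (N+1), a i • e i
  have hΦc : Continuous Φ := by
    refine continuous_finsetSum _ fun i _ => ?_
    exact (continuous_apply i).smul continuous_const
  have hΦs : ∀ a, Supp e (N+1) (Φ a) := fun a i hi => by
    rw [inner_sum]
    exact Finset.sum_eq_zero fun j _ => by
      rw [inner_smul_right, he.2 (by have := j.2; omega), mul_zero]
  have hΦx : ∀ x, Supp e (N+1) x → ‖x‖ ≤ ρ → ∃ a : Fin (N+1) → ℂ, Φ a = x ∧ ∀ i, ‖a i‖ ≤ ρ := by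
    intro x hx hxρ
    refine ⟨fun i => inner ℂ (e i) x, ?_, fun i => (norm_inner_e he _ _).trans hxρ⟩
    conv_rhs => rw [← hx.eq he hd, Pr_apply]
    rw [Finset.sum_range (fun j => inner ℂ (e j) x • e j)]
  let U : ℂ[X] → Set ((Fin (N+1) → ℂ) × (Fin (N+1) → ℂ)) := fun q =>
    {p | ‖aeval A q (Φ p.1) - Φ p.2‖ < ε ∨ ‖aeval A q (Φ p.2) - Φ p.1‖ < ε}
  have hU : ∀ q, IsOpen (U q) := fun q => by
    have c1 : Continuous fun p : (Fin (N+1) → ℂ) × (Fin (N+1) → ℂ) => Φ p.1 :=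
      hΦc.comp continuous_fst
    have c2 : Continuous fun p : (Fin (N+1) → ℂ) × (Fin (N+1) → ℂ) => Φ p.2 :=
      hΦc.comp continuous_snd
    have o1 : IsOpen {p : (Fin (N+1) → ℂ) × (Fin (N+1) → ℂ) | ‖aeval A q (Φ p.1) - Φ p.2‖ < ε} :=
      isOpen_lt (((aeval A q).continuous.comp c1).sub c2).norm continuous_const
    have o2 : IsOpen {p : (Fin (N+1) → ℂ) × (Fin (N+1) → ℂ) | ‖aeval A q (Φ p.2) - Φ p.1‖ < ε} :=
      isOpen_lt (((aeval A q).continuous.comp c2).sub c1).norm continuous_const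
    exact o1.union o2
  obtain ⟨F, hF⟩ := (isCompact_closedBall (0 : (Fin (N+1) → ℂ) × (Fin (N+1) → ℂ))
    (max ρ 0)).elim_finite_subcover U hU (fun p _ => by
      rw [Set.mem_iUnion]
      obtain ⟨q, hq⟩ := g.chain he hd (hΦs p.1) (hΦs p.2)
      refine ⟨q, hq.imp (fun h => ?_) (fun h => ?_)⟩
      · rw [h, sub_self, norm_zero]; exact hε
      · rw [h, sub_self, norm_zero]; exact hε)
  have hs : 0 ≤ ∑ q ∈ F, wq q := sum_nonneg fun q _ => wq_nonneg q
  refine ⟨1 + ∑ q ∈ F, wq q, by linarith, fun x y hx hy hxρ hyρ => ?_⟩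
  obtain ⟨a, rfl, ha⟩ := hΦx x hx hxρ
  obtain ⟨a', rfl, ha'⟩ := hΦx y hy hyρ
  have hmem : (a, a') ∈ Metric.closedBall (0 : (Fin (N+1) → ℂ) × (Fin (N+1) → ℂ)) (max ρ 0) := by
    rw [mem_closedBall_zero_iff, Prod.norm_def]
    refine max_le ?_ ?_
    · exact (pi_norm_le_iff_of_nonneg (le_max_right _ _)).mpr fun i => (ha i).trans (le_max_left _ _)
    · exact (pi_norm_le_iff_of_nonneg (le_max_right _ _)).mpr fun i => (ha' i).trans (le_max_left _ _)
  have h1 := hF hmem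
  simp only [Set.mem_iUnion] at h1
  obtain ⟨q, hqF, hq⟩ := h1
  refine ⟨q, ?_, hq⟩
  have := single_le_sum (f := wq) (fun q _ => wq_nonneg q) hqF
  linarith

lemma aeval_apply_sum (T : H →L[ℂ] H) (q : ℂ[X]) (x : H) :
    aeval T q x = ∑ i ∈ range (q.natDegree + 1), q.coeff i • (T ^ i) x := by
  rw [aeval_eq_sum_range, _root_.sum_apply]; rfl

lemma wq_bound {T : H →L[ℂ] H} (hT : ‖T‖ ≤ 7) (q : ℂ[X]) (x : H) :
    ‖aeval T q x‖ ≤ wq q * ‖x‖ := by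
  rw [aeval_apply_sum, wq, sum_mul]
  refine (norm_sum_le _ _).trans (sum_le_sum fun i _ => ?_)
  rw [norm_smul, mul_assoc]
  refine mul_le_mul_of_nonneg_left ?_ (norm_nonneg _)
  refine ((T ^ i).le_opNorm x).trans (mul_le_mul_of_nonneg_right ?_ (norm_nonneg _))
  refine (pow_norm_le hT i).trans ?_
  have : (0:ℝ) ≤ i * 7 ^ i := by positivity
  linarith

lemma wq_diff {T A : H →L[ℂ] H} (hT : ‖T‖ ≤ 7) (hA : ‖A‖ ≤ 7) {V : Set H} {ε : ℝ} (hε : 0 ≤ ε)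
    (hV : ∀ x ∈ V, A x ∈ V ∧ ‖T x - A x‖ ≤ ε * ‖x‖) (q : ℂ[X]) {x : H} (hx : x ∈ V) :
    ‖aeval T q x - aeval A q x‖ ≤ wq q * ε * ‖x‖ := by
  have key : ∀ i : ℕ, ∀ x ∈ V, ‖(T ^ i) x - (A ^ i) x‖ ≤ ((i + 1) * 7 ^ i) * (ε * ‖x‖) := by
    intro i
    induction i with
    | zero => intro x _; simp; positivity
    | succ i ih =>
      intro x hx
      have h1 : (T ^ (i+1)) x - (A ^ (i+1)) x = (T ^ i) (T x - A x) +
          ((T ^ i) (A x) - (A ^ i) (A x)) := by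
        rw [pow_succ, pow_succ, map_sub]
        change (T ^ i) (T x) - (A ^ i) (A x) = _
        abel
      rw [h1]
      refine (norm_add_le _ _).trans ?_
      have a1 : ‖(T ^ i) (T x - A x)‖ ≤ 7 ^ i * (ε * ‖x‖) :=
        ((T ^ i).le_opNorm _).trans (mul_le_mul (pow_norm_le hT i) (hV x hx).2 (norm_nonneg _)
          (by positivity))
      have a2 := ih (A x) (hV x hx).1
      have a3 : ‖A x‖ ≤ 7 * ‖x‖ := (A.le_opNorm x).trans
        (mul_le_mul_of_nonneg_right hA (norm_nonneg _))
      have a4 : ((i:ℝ) + 1) * 7 ^ i * (ε * ‖A x‖) ≤ ((i:ℝ) + 1) * 7 ^ i * (ε * (7 * ‖x‖)) := by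
        gcongr
      have a5 : 0 ≤ (7:ℝ) ^ i * (ε * ‖x‖) := by positivity
      refine (add_le_add a1 (a2.trans a4)).trans ?_
      push_cast
      rw [pow_succ]
      nlinarith
  rw [aeval_apply_sum, aeval_apply_sum, ← sum_sub_distrib, wq, mul_assoc, sum_mul]
  refine (norm_sum_le _ _).trans (sum_le_sum fun i _ => ?_)
  rw [← smul_sub, norm_smul, mul_assoc]
  exact mul_le_mul_of_nonneg_left (key i x hx) (norm_nonneg _)
end compactPart
end partG

section partH
open Finset
variable {H : Type} [NormedAddCommGroup H] [InnerProductSpace ℂ H]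
variable {e : ℕ → H} {N : ℕ} {A : H →L[ℂ] H} {cons : List (ℕ × ℕ)} {lam b : ℂ} {c h : ℕ}
  {K μ : ℕ → ℂ} {v : ℕ → H} {A' : H →L[ℂ] H}
structure St (e : ℕ → H) where
  N : ℕ
  A : H →L[ℂ] H
  cons : List (ℕ × ℕ)
  good : Good e N A cons
  mem : (1, 0) ∈ cons

lemma St.norm_le (s : St e) : ‖s.A‖ ≤ 7 := by
  obtain ⟨-, -, C, hC0, hC7, h⟩ := s.good.cons _ s.mem
  refine ContinuousLinearMap.opNorm_le_bound _ (by norm_num) fun x => ?_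
  have := h x (fun i hi => absurd hi (by simp))
  simp only [pow_one] at this
  refine this.trans ?_
  gcongr

lemma St.init (he : Orthonormal ℂ e) : Nonempty (St e) := by
  refine ⟨⟨0, 0, [(1, 0)], ⟨fun j _ => rfl, fun j => supp_zero, fun x => supp_zero, rfl,
    ⟨1, one_ne_zero, by simp⟩, ?_, ?_⟩, by simp⟩⟩
  · intro j hj
    obtain rfl : j = 0 := by omega
    exact Submodule.subset_span ⟨0, by simp⟩
  · intro p hp
    obtain rfl : p = (1, 0) := by simpa using hp
    exact ⟨le_rfl, by simp, 0, le_rfl, by norm_num, fun x _ => by simp⟩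

structure Nx (s s' : St e) (c : ℕ) (b : ℂ) (ε : ℝ) : Prop where
  cons : s'.cons = (c, s.N + 1) :: s.cons
  lt : s.N + c < s'.N
  eq : ∀ j < s.N, s'.A (e j) = s.A (e j)
  small : ‖s'.A (e s.N)‖ ≤ ε
  approx : ∀ j ≤ s.N, ‖(s'.A ^ c) (e j) - (1/2 : ℂ) • e j - b • s'.A (e j)‖ ≤ ε

lemma St.next (he : Orthonormal ℂ e)
    (hd : (Submodule.span ℂ (Set.range e)).topologicalClosure = ⊤) (s : St e) (b : ℂ) {ε : ℝ}
    (hε : 0 < ε) : ∃ (s' : St e) (c : ℕ), Nx s s' c b ε := by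
  obtain ⟨N', A', c, h1, h2, h3, h4, h5⟩ := RT.step he hd s.good b hε
  exact ⟨⟨N', A', _, h1, List.mem_cons_of_mem _ s.mem⟩, c, ⟨rfl, h2, h3, h4, h5⟩⟩

lemma exists_seq (he : Orthonormal ℂ e)
    (hd : (Submodule.span ℂ (Set.range e)).topologicalClosure = ⊤) (bb : ℕ → St e → ℂ)
    (εε : ℕ → St e → ℝ) (hε : ∀ n s, 0 < εε n s) :
    ∃ (s : ℕ → St e) (c : ℕ → ℕ), ∀ n, Nx (s n) (s (n+1)) (c n) (bb n (s n)) (εε n (s n)) := by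
  choose nx cc h using fun (n : ℕ) (s : St e) => s.next he hd (bb n s) (hε n s)
  obtain ⟨s0⟩ := St.init he
  let s : ℕ → St e := fun n => Nat.rec s0 (fun n s => nx n s) n
  exact ⟨s, fun n => cc n (s n), fun n => h n (s n)⟩

theorem exists_T [CompleteSpace H] (he : Orthonormal ℂ e)
    (hd : (Submodule.span ℂ (Set.range e)).topologicalClosure = ⊤) (bb : ℕ → St e → ℂ)
    (εε : ℕ → St e → ℝ) (hε : ∀ n s, 0 < εε n s) :
    ∃ (s : ℕ → St e) (c : ℕ → ℕ) (T : H →L[ℂ] H), ‖T‖ ≤ 7 ∧ (∀ n, n ≤ (s n).N) ∧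
      (∀ n, ∀ j < (s n).N, T (e j) = (s n).A (e j)) ∧
      (∀ n, ‖T (e (s n).N)‖ ≤ εε n (s n)) ∧
      (∀ n, ∀ j ≤ (s n).N,
        ‖(T ^ c n) (e j) - (1/2 : ℂ) • e j - (bb n (s n)) • T (e j)‖ ≤ εε n (s n)) ∧
      (∀ n x, Tail e ((s n).N + 1) x → ‖(T ^ c n) x‖ ≤ 7 * ‖x‖) := by
  obtain ⟨s, c, hs⟩ := exists_seq he hd bb εε hε
  have hlt : ∀ n, (s n).N < (s (n+1)).N := fun n => by have := (hs n).lt; omega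
  have hmono : StrictMono fun n => (s n).N := strictMono_nat_of_lt_succ hlt
  have hge : ∀ n, n ≤ (s n).N := fun n => hmono.id_le n
  have hcon : ∀ n m, n ≤ m → ∀ j < (s n).N, (s m).A (e j) = (s n).A (e j) := by
    intro n m hnm j hj
    induction m, hnm using Nat.le_induction with
    | base => rfl
    | succ m hm ih => rw [(hs m).eq j (lt_of_lt_of_le hj (hmono.monotone hm)), ih]
  have hconS : ∀ n m, n ≤ m → ∀ x, Supp e (s n).N x → (s m).A x = (s n).A x :=
    fun n m hnm x hx => map_congr he hd hx _ _ fun j hj => hcon n m hnm j hj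
  have hcau : ∀ x, CauchySeq fun n => (s n).A x := by
    intro x
    rw [Metric.cauchySeq_iff']
    intro ε hε0
    obtain ⟨k, hk⟩ := (Metric.tendsto_atTop.mp (Pr_tendsto he hd x)) (ε / 15) (by positivity)
    have hk := hk k le_rfl
    refine ⟨k, fun n hn => ?_⟩
    have h1 := hconS k n hn (Pr e k x) ((supp_Pr he k x).mono (hge k))
    have h2 : (s n).A x - (s k).A x = (s n).A (x - Pr e k x) - (s k).A (x - Pr e k x) := by
      rw [map_sub, map_sub, h1]; abel
    rw [dist_eq_norm, h2]
    have a : ∀ n, ‖(s n).A (x - Pr e k x)‖ ≤ 7 * ‖x - Pr e k x‖ := fun n =>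
      ((s n).A.le_opNorm _).trans (mul_le_mul_of_nonneg_right (s n).norm_le (norm_nonneg _))
    rw [dist_comm, dist_eq_norm] at hk
    have := norm_sub_le ((s n).A (x - Pr e k x)) ((s k).A (x - Pr e k x))
    have b1 := a n
    have b2 := a k
    linarith
  choose f hf using fun x => cauchySeq_tendsto_of_complete (hcau x)
  let T := continuousLinearMapOfTendsto (fun n => (s n).A) (tendsto_pi_nhds.mpr hf)
  have hTf : ∀ x, Filter.Tendsto (fun n => (s n).A x) Filter.atTop (nhds (T x)) := hf
  have hT7 : ‖T‖ ≤ 7 := by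
    refine ContinuousLinearMap.opNorm_le_bound _ (by norm_num) fun x => ?_
    refine le_of_tendsto (hTf x).norm (Filter.Eventually.of_forall fun n => ?_)
    exact ((s n).A.le_opNorm _).trans (mul_le_mul_of_nonneg_right (s n).norm_le (norm_nonneg _))
  have hTe : ∀ n, ∀ j < (s n).N, T (e j) = (s n).A (e j) := fun n j hj => by
    refine tendsto_nhds_unique (hTf (e j)) ?_
    refine tendsto_const_nhds.congr' ?_
    filter_upwards [Filter.eventually_ge_atTop n] with m hm
    exact (hcon n m hm j hj).symm
  have hTp : ∀ n i k x, Supp e k x → k + i ≤ (s n).N + 1 → 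
      (T ^ i) x = ((s n).A ^ i) x := by
    intro n i k x hx
    induction i with
    | zero => intro _; simp
    | succ i ih =>
      intro hi
      rw [pow_succ', pow_succ']
      change T ((T ^ i) x) = (s n).A (((s n).A ^ i) x)
      rw [ih (by omega)]
      exact map_congr he hd ((s n).good.supp_pow he hd hx i) _ _ fun j hj => hTe n j (by omega)
  have hmemc : ∀ n m, n < m → (c n, (s n).N + 1) ∈ (s m).cons := by
    intro n m hnm
    induction m, hnm using Nat.le_induction with
    | base => rw [(hs n).cons]; exact List.mem_cons_self
    | succ m hm ih => rw [(hs m).cons]; exact List.mem_cons_of_mem _ ih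
  refine ⟨s, c, T, hT7, hge, hTe, fun n => ?_, fun n j hj => ?_, fun n x hx => ?_⟩
  · rw [hTe (n+1) _ (hlt n)]; exact (hs n).small
  · have h1 := (hs n).lt
    rw [hTp (n+1) (c n) (j+1) (e j) (supp_e he (by omega)) (by omega),
      hTe (n+1) j (by omega)]
    exact (hs n).approx j hj
  · have hlim : Filter.Tendsto (fun k => (T ^ c n) (Pr e k x)) Filter.atTop
        (nhds ((T ^ c n) x)) := ((T ^ c n).continuous.tendsto x).comp (Pr_tendsto he hd x)
    refine le_of_tendsto hlim.norm (Filter.Eventually.of_forall fun k => ?_)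
    set m := n + 1 + k + c n with hm
    have h1 := hge m
    rw [hTp m (c n) k _ (supp_Pr he k x) (by omega)]
    obtain ⟨-, -, C, hC0, hC7, h⟩ := (s m).good.cons _ (hmemc n m (by omega))
    have ht : Tail e ((s n).N + 1) (Pr e k x) := fun i hi => by
      rw [inner_Pr he, hx i hi]; simp
    refine (h _ ht).trans ?_
    exact mul_le_mul hC7.le (Pr_norm_le he k x) (norm_nonneg _) (by norm_num)
end partH

section partI
open Finset
variable {H : Type} [NormedAddCommGroup H] [InnerProductSpace ℂ H]
variable {e : ℕ → H} {N : ℕ} {A : H →L[ℂ] H} {cons : List (ℕ × ℕ)} {lam b : ℂ} {c h : ℕ}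
  {K μ : ℕ → ℂ} {v : ℕ → H} {A' : H →L[ℂ] H}
section finalPart
open Polynomial

lemma err_head (he : Orthonormal ℂ e)
    (hd : (Submodule.span ℂ (Set.range e)).topologicalClosure = ⊤) {T : H →L[ℂ] H} {ε : ℝ}
    (hap : ∀ j ≤ N, ‖(T ^ c) (e j) - (1/2 : ℂ) • e j - b • T (e j)‖ ≤ ε)
    (htl : ∀ x, Tail e (N + 1) x → ‖(T ^ c) x‖ ≤ 7 * ‖x‖) (hε : 0 ≤ ε) (x : H) :
    ‖(T ^ c) x - (1/2 : ℂ) • x - b • T (Pr e (N+1) x)‖ ≤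
      (N + 1) * ε * ‖x‖ + 8 * ‖x - Pr e (N+1) x‖ := by
  set p := Pr e (N+1) x with hp
  have h1 := map_bound he hd (supp_Pr he (N+1) x)
    (T ^ c - (1/2 : ℂ) • (1 : H →L[ℂ] H) - b • T) (ε := ε) (fun j hj => by
      have := hap j (by omega)
      simpa only [ContinuousLinearMap.sub_apply, ContinuousLinearMap.smul_apply,
        ContinuousLinearMap.one_apply] using this)
  simp only [ContinuousLinearMap.sub_apply, ContinuousLinearMap.smul_apply,
        ContinuousLinearMap.one_apply] at h1
  rw [← hp] at h1
  have h2 : ‖(T ^ c) (x - p)‖ ≤ 7 * ‖x - p‖ := htl _ (tail_compl he (N+1) x)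
  have h3 : ‖(1/2 : ℂ) • (x - p)‖ = 1/2 * ‖x - p‖ := by rw [norm_smul]; norm_num
  have h4 : (T ^ c) x - (1/2 : ℂ) • x - b • T p = ((T ^ c) p - (1/2 : ℂ) • p - b • T p)
      + ((T ^ c) (x - p) - (1/2 : ℂ) • (x - p)) := by
    rw [map_sub, smul_sub]; abel
  have h5 : ‖p‖ ≤ ‖x‖ := Pr_norm_le he _ x
  rw [h4]
  have h6 := norm_add_le ((T ^ c) p - (1/2 : ℂ) • p - b • T p)
    ((T ^ c) (x - p) - (1/2 : ℂ) • (x - p))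
  have h7 := norm_sub_le ((T ^ c) (x - p)) ((1/2 : ℂ) • (x - p))
  have h8 : ((N + 1 : ℕ) : ℝ) * ε * ‖p‖ ≤ (N + 1) * ε * ‖x‖ := by push_cast; gcongr
  have h9 := norm_nonneg (x - p)
  linarith

lemma err_tot (he : Orthonormal ℂ e)
    (hd : (Submodule.span ℂ (Set.range e)).topologicalClosure = ⊤) {T : H →L[ℂ] H} {ε : ℝ}
    (hT : ‖T‖ ≤ 7)
    (hap : ∀ j ≤ N, ‖(T ^ c) (e j) - (1/2 : ℂ) • e j - b • T (e j)‖ ≤ ε)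
    (htl : ∀ x, Tail e (N + 1) x → ‖(T ^ c) x‖ ≤ 7 * ‖x‖) (hε : 0 ≤ ε) (x : H) :
    ‖(T ^ c) x - ((1/2 : ℂ) • x + b • T x)‖ ≤
      (N + 1) * ε * ‖x‖ + (8 + 7 * ‖b‖) * ‖x - Pr e (N+1) x‖ := by
  have h1 := err_head he hd hap htl hε x
  have h2 : ‖b • T (x - Pr e (N+1) x)‖ ≤ ‖b‖ * (7 * ‖x - Pr e (N+1) x‖) := by
    rw [norm_smul]
    gcongr
    exact (T.le_opNorm _).trans (by gcongr)
  have h3 : (T ^ c) x - ((1/2 : ℂ) • x + b • T x) =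
      ((T ^ c) x - (1/2 : ℂ) • x - b • T (Pr e (N+1) x)) - b • T (x - Pr e (N+1) x) := by
    rw [map_sub, smul_sub]; abel
  rw [h3]
  refine (norm_sub_le _ _).trans ?_
  linarith

lemma chain_step (he : Orthonormal ℂ e)
    (hd : (Submodule.span ℂ (Set.range e)).topologicalClosure = ⊤) {T : H →L[ℂ] H}
    (hT : ‖T‖ ≤ 7) (hA : ‖A‖ ≤ 7) (g : Good e N A cons) {Λ δ : ℝ} (hΛ : 1 ≤ Λ) (hδ : 0 < δ)
    (hδ1 : δ ≤ 1) (hTA : ∀ j < N, T (e j) = A (e j)) (hTN : ‖T (e N)‖ ≤ δ / ((N + 1) * Λ))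
    (hap : ∀ j ≤ N, ‖(T ^ c) (e j) - (1/2 : ℂ) • e j - ((Λ / δ : ℝ) : ℂ) • T (e j)‖
      ≤ δ / ((N + 1) * Λ))
    (htl : ∀ x, Tail e (N + 1) x → ‖(T ^ c) x‖ ≤ 7 * ‖x‖) {x y : H} {q : ℂ[X]} (hq : wq q ≤ Λ)
    (hxy : ‖aeval A q (Pr e (N+1) x) - Pr e (N+1) y‖ < δ) :
    ∃ z ∈ MO T x, ‖z - T y‖ ≤ (16 * ‖x‖ + 7) * δ + 7 * ‖y - Pr e (N+1) y‖ := by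
  have hΛ0 : 0 < Λ := by linarith
  have hN0 : (0:ℝ) < N + 1 := by positivity
  have hε : 0 ≤ δ / ((N + 1) * Λ) := by positivity
  set ε := δ / ((N + 1) * Λ) with hεd
  have hNε : (N + 1) * ε = δ / Λ := by rw [hεd]; field_simp
  have hεδ : Λ * ε ≤ δ := by
    have : Λ * ε = δ / (N + 1) := by rw [hεd]; field_simp
    rw [this]
    exact div_le_self hδ.le (by have : (0:ℝ) ≤ N := by positivity
                                linarith)
  set β : ℂ := ((Λ / δ : ℝ) : ℂ) with hβ
  have hβ0 : β ≠ 0 := by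
    rw [hβ, Complex.ofReal_ne_zero]; positivity
  have hβn : ‖β⁻¹‖ = δ / Λ := by
    rw [norm_inv, hβ, Complex.norm_real, Real.norm_of_nonneg (by positivity), inv_div]
  have h1 := err_head he hd hap htl hε x
  set p := Pr e (N+1) x with hp
  set p' := Pr e (N+1) y with hp'
  have hpx : ‖p‖ ≤ ‖x‖ := Pr_norm_le he _ x
  set r := (T ^ c) x - (1/2 : ℂ) • x - β • T p with hr
  have hrn : ‖r‖ ≤ 9 * ‖x‖ := by
    have h2 : ‖x - p‖ ≤ ‖x‖ := Pr_compl_norm_le he _ x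
    have h3 : (N + 1) * ε * ‖x‖ ≤ 1 * ‖x‖ := by
      gcongr
      rw [hNε]
      exact (div_le_one hΛ0).mpr (by linarith)
    linarith
  have hw := wq_nonneg q
  have hdiff := wq_diff hT hA hε (V := {z | Supp e (N+1) z}) (fun z hz => ⟨g.suppN z, by
    have hz2 : (T - A) z = inner ℂ (e N) z • T (e N) := by
      conv_lhs => rw [← Supp.eq he hd hz, Pr_apply, sum_range_succ, map_add, map_sum]
      rw [sum_eq_zero, zero_add, map_smul]
      · simp [g.last]
      · intro j hj
        rw [map_smul, ContinuousLinearMap.sub_apply, hTA j (mem_range.mp hj), sub_self, smul_zero]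
    rw [ContinuousLinearMap.sub_apply] at hz2
    rw [hz2, norm_smul, mul_comm]
    have := norm_inner_e he N z
    gcongr⟩) q (x := p) (supp_Pr he _ x)
  refine ⟨β⁻¹ • aeval T q ((T ^ c) x - (1/2 : ℂ) • x), ?_, ?_⟩
  · refine Submodule.smul_mem _ _ (aeval_mem T _ (fun _ hy => MO_inv T x hy) q ?_)
    have hm : ∀ n : ℕ, (T ^ n) x ∈ MO T x := fun n =>
      Submodule.le_topologicalClosure _ (Submodule.subset_span ⟨n, rfl⟩)
    exact sub_mem (hm c) (Submodule.smul_mem _ _ (by simpa using hm 0))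
  · have h2 : (T ^ c) x - (1/2 : ℂ) • x = β • T p + r := by rw [hr]; abel
    have hcomm : aeval T q (T p) = T (aeval T q p) := by
      have h3 := aeval_mul_apply T q X p
      have h4 := aeval_mul_apply T X q p
      rw [aeval_X] at h3 h4
      rw [← h3, ← h4, mul_comm]
    have h5 : β⁻¹ • aeval T q ((T ^ c) x - (1/2 : ℂ) • x) - T y =
        T ((aeval T q p - aeval A q p) + (aeval A q p - p') - (y - p')) + β⁻¹ • aeval T q r := by
      rw [h2, map_add, map_smul, smul_add, smul_smul, inv_mul_cancel₀ hβ0, one_smul, hcomm]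
      simp only [map_add, map_sub]
      abel
    rw [h5]
    have h6 : ‖β⁻¹ • aeval T q r‖ ≤ 9 * ‖x‖ * δ := by
      rw [norm_smul, hβn]
      have := wq_bound hT q r
      calc δ / Λ * ‖aeval T q r‖ ≤ δ / Λ * (Λ * (9 * ‖x‖)) := by
            gcongr
            refine this.trans ?_
            gcongr
        _ = _ := by field_simp
    have h7 : wq q * ε * ‖p‖ ≤ δ * ‖x‖ := by
      have : wq q * ε ≤ Λ * ε := by gcongr
      have := this.trans hεδ
      gcongr
    have h8 : ‖T ((aeval T q p - aeval A q p) + (aeval A q p - p') - (y - p'))‖ ≤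
        7 * (δ * ‖x‖ + δ + ‖y - p'‖) := by
      refine (T.le_opNorm _).trans ?_
      gcongr
      refine (norm_sub_le _ _).trans ?_
      gcongr
      refine (norm_add_le _ _).trans ?_
      exact add_le_add (hdiff.trans h7) hxy.le
    refine (norm_add_le _ _).trans ?_
    linarith

theorem exists_final [CompleteSpace H] (he : Orthonormal ℂ e)
    (hd : (Submodule.span ℂ (Set.range e)).topologicalClosure = ⊤) :
    ∃ T : H →L[ℂ] H, (∀ x (β : ℂ), (1/2 : ℂ) • x + β • T x ∈ EO T x) ∧
      (∀ x y, T y ∈ MO T x ∨ T x ∈ MO T y) := by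
  choose Λ hΛ1 hΛ using fun (n : ℕ) (s : St e) =>
    s.good.compact he hd (n : ℝ) (ε := 1 / ((n : ℝ) + 1)) (by positivity)
  let d : ℕ → ℂ := TopologicalSpace.denseSeq ℂ
  let εε : ℕ → St e → ℝ := fun n s => (1 / ((n : ℝ) + 1)) / ((s.N + 1) * Λ n s)
  have hεε : ∀ n s, 0 < εε n s := fun n s => by
    have : 0 < Λ n s := lt_of_lt_of_le one_pos (hΛ1 n s)
    positivity
  let bb : ℕ → St e → ℂ := fun n s => if n % 2 = 0 then d (Nat.unpair (n / 2)).1 else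
    ((Λ n s / (1 / ((n : ℝ) + 1)) : ℝ) : ℂ)
  obtain ⟨s, c, T, hT7, hge, hTA, hTN, hap, htl⟩ := exists_T he hd bb εε hεε
  have hδ : Filter.Tendsto (fun n : ℕ => 1 / ((n : ℝ) + 1)) Filter.atTop (nhds 0) :=
    tendsto_one_div_add_atTop_nhds_zero_nat
  have hPr : ∀ x, Filter.Tendsto (fun n => ‖x - Pr e ((s n).N + 1) x‖) Filter.atTop (nhds 0) := by
    intro x
    have h1 : Filter.Tendsto (fun n => (s n).N + 1) Filter.atTop Filter.atTop :=
      Filter.tendsto_atTop_mono (fun n => (hge n).trans (Nat.le_succ _)) Filter.tendsto_id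
    have h2 := (tendsto_const_nhds (x := x)).sub ((Pr_tendsto he hd x).comp h1)
    simpa using h2.norm
  refine ⟨T, fun x => ?_, fun x y => ?_⟩
  · have hk : ∀ k, (1/2 : ℂ) • x + d k • T x ∈ EO T x := by
      intro k
      let φ : ℕ → ℕ := fun m => 2 * Nat.pair k m
      have hφ : Filter.Tendsto φ Filter.atTop Filter.atTop :=
        Filter.tendsto_atTop_mono (fun m => by
          have := Nat.right_le_pair k m
          simp only [φ, id]; omega) Filter.tendsto_id
      have hb : ∀ m, bb (φ m) (s (φ m)) = d k := fun m => by
        simp [bb, φ]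
      have hlim : Filter.Tendsto (fun m => (T ^ c (φ m)) x) Filter.atTop
          (nhds ((1/2 : ℂ) • x + d k • T x)) := by
        rw [tendsto_iff_norm_sub_tendsto_zero]
        have hbd : Filter.Tendsto (fun m => (1 / ((φ m : ℝ) + 1)) * ‖x‖ +
            (8 + 7 * ‖d k‖) * ‖x - Pr e ((s (φ m)).N + 1) x‖) Filter.atTop (nhds 0) := by
          have := ((hδ.comp hφ).mul_const ‖x‖).add
            (((hPr x).comp hφ).const_mul (8 + 7 * ‖d k‖))
          simpa [Function.comp_def] using this
        refine squeeze_zero (fun _ => norm_nonneg _) (fun m => ?_) hbd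
        have h1 := err_tot he hd hT7 (hap (φ m)) (htl (φ m)) (hεε _ _).le x
        rw [hb] at h1
        refine h1.trans ?_
        have hL := hΛ1 (φ m) (s (φ m))
        have h2 : ((s (φ m)).N + 1 : ℝ) * εε (φ m) (s (φ m)) ≤ 1 / ((φ m : ℝ) + 1) := by
          have : ((s (φ m)).N + 1 : ℝ) * εε (φ m) (s (φ m)) =
              (1 / ((φ m : ℝ) + 1)) / Λ (φ m) (s (φ m)) := by
            have : (0:ℝ) < (s (φ m)).N + 1 := by positivity
            have : 0 < Λ (φ m) (s (φ m)) := by linarith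
            simp only [εε]
            field_simp
          rw [this]
          exact div_le_self (by positivity) hL
        gcongr
      exact isClosed_closure.mem_of_tendsto hlim (Filter.Eventually.of_forall fun m => mem_EO T x _)
    intro β
    have hcl : IsClosed {β : ℂ | (1/2 : ℂ) • x + β • T x ∈ EO T x} :=
      isClosed_closure.preimage (by fun_prop)
    have hsub : Set.range d ⊆ {β : ℂ | (1/2 : ℂ) • x + β • T x ∈ EO T x} := by
      rintro _ ⟨k, rfl⟩; exact hk k
    have := closure_minimal hsub hcl
    rw [(TopologicalSpace.denseRange_denseSeq ℂ).closure_range] at this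
    exact this trivial
  · have alt : ∀ x y, (∃ᶠ m : ℕ in Filter.atTop, ∃ q : ℂ[X],
        wq q ≤ Λ (2*m+1) (s (2*m+1)) ∧ ‖aeval (s (2*m+1)).A q (Pr e ((s (2*m+1)).N+1) x) -
          Pr e ((s (2*m+1)).N+1) y‖ < 1 / (((2*m+1 : ℕ) : ℝ) + 1)) → T y ∈ MO T x := by
      intro x y hfr
      have hψ : Filter.Tendsto (fun m : ℕ => 2*m+1) Filter.atTop Filter.atTop :=
        Filter.tendsto_atTop_mono (fun m => by simp only [id]; omega) Filter.tendsto_id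
      have hbd : Filter.Tendsto (fun m : ℕ => (16 * ‖x‖ + 7) * (1 / (((2*m+1 : ℕ) : ℝ) + 1)) +
            7 * ‖y - Pr e ((s (2*m+1)).N + 1) y‖) Filter.atTop (nhds 0) := by
        have := ((hδ.comp hψ).const_mul (16 * ‖x‖ + 7)).add (((hPr y).comp hψ).const_mul 7)
        simpa [Function.comp_def] using this
      have hcl : (MO T x : Set H) = closure (MO T x : Set H) :=
        (Submodule.isClosed_topologicalClosure _).closure_eq.symm
      change T y ∈ (MO T x : Set H)
      rw [hcl, Metric.mem_closure_iff]
      intro ε hε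
      obtain ⟨m, ⟨q, hq, hxy⟩, hm⟩ := (hfr.and_eventually (hbd.eventually_lt_const hε)).exists
      have hbm : bb (2*m+1) (s (2*m+1)) =
          ((Λ (2*m+1) (s (2*m+1)) / (1 / (((2*m+1 : ℕ) : ℝ) + 1)) : ℝ) : ℂ) :=
        if_neg (by omega)
      have hap' := hap (2*m+1)
      rw [hbm] at hap'
      obtain ⟨z, hz, hzy⟩ := chain_step he hd hT7 (s (2*m+1)).norm_le (s (2*m+1)).good
        (hΛ1 (2*m+1) (s (2*m+1))) (δ := 1 / (((2*m+1 : ℕ) : ℝ) + 1)) (by positivity)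
        (by rw [div_le_one (by positivity)]; have : (0:ℝ) ≤ ((2*m+1 : ℕ) : ℝ) := by positivity
            linarith) (hTA (2*m+1)) (hTN (2*m+1)) hap' (htl (2*m+1)) hq hxy
      exact ⟨z, hz, by rw [dist_comm, dist_eq_norm]; exact lt_of_le_of_lt hzy hm⟩
    have hor : ∃ᶠ m : ℕ in Filter.atTop, (∃ q : ℂ[X],
        wq q ≤ Λ (2*m+1) (s (2*m+1)) ∧ ‖aeval (s (2*m+1)).A q (Pr e ((s (2*m+1)).N+1) x) -
          Pr e ((s (2*m+1)).N+1) y‖ < 1 / (((2*m+1 : ℕ) : ℝ) + 1)) ∨ (∃ q : ℂ[X],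
        wq q ≤ Λ (2*m+1) (s (2*m+1)) ∧ ‖aeval (s (2*m+1)).A q (Pr e ((s (2*m+1)).N+1) y) -
          Pr e ((s (2*m+1)).N+1) x‖ < 1 / (((2*m+1 : ℕ) : ℝ) + 1)) := by
      apply Filter.Eventually.frequently
      obtain ⟨M, hM⟩ := exists_nat_ge (max ‖x‖ ‖y‖)
      filter_upwards [Filter.eventually_ge_atTop M] with m hm
      have hmM : (M : ℝ) ≤ ((2*m+1 : ℕ) : ℝ) := by exact_mod_cast (by omega : M ≤ 2*m+1)
      have hx := (le_max_left ‖x‖ ‖y‖).trans (hM.trans hmM)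
      have hy := (le_max_right ‖x‖ ‖y‖).trans (hM.trans hmM)
      obtain ⟨q, hq, h | h⟩ := hΛ (2*m+1) (s (2*m+1)) _ _ (supp_Pr he _ x) (supp_Pr he _ y)
        ((Pr_norm_le he _ x).trans hx) ((Pr_norm_le he _ y).trans hy)
      · exact Or.inl ⟨q, hq, h⟩
      · exact Or.inr ⟨q, hq, h⟩
    rw [Filter.frequently_or_distrib] at hor
    exact hor.imp (alt x y) (alt y x)

lemma exists_basis [CompleteSpace H] [TopologicalSpace.SeparableSpace H]
    (hdim : ¬ FiniteDimensional ℂ H) : ∃ e : ℕ → H, Orthonormal ℂ e ∧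
      (Submodule.span ℂ (Set.range e)).topologicalClosure = ⊤ := by
  obtain ⟨w, b, hb⟩ := exists_hilbertBasis ℂ H
  have hcnt : Countable w := by
    have hsep : Set.PairwiseDisjoint (Set.univ : Set w) (fun i => Metric.ball (b i) (1/2)) := by
      intro i _ j _ hij
      refine Metric.ball_disjoint_ball ?_
      have h1 : ‖b i - b j‖ ^ 2 = 2 := by
        rw [@norm_sub_sq ℂ, b.orthonormal.2 hij, b.orthonormal.1, b.orthonormal.1]; norm_num
      rw [dist_eq_norm]
      nlinarith [norm_nonneg (b i - b j)]
    have := hsep.countable_of_isOpen (fun i _ => Metric.isOpen_ball)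
      (fun i _ => ⟨b i, by simp⟩)
    exact Set.countable_univ_iff.mp this
  have hinf : Infinite w := by
    by_contra hfin
    rw [not_infinite_iff_finite] at hfin
    have := Fintype.ofFinite w
    exact hdim (Module.Basis.finiteDimensional_of_finite b.toOrthonormalBasis.toBasis)
  obtain ⟨f⟩ := nonempty_equiv_of_countable (α := ℕ) (β := w)
  refine ⟨fun n => b (f n), b.orthonormal.comp f f.injective, ?_⟩
  have : Set.range (fun n => b (f n)) = Set.range b := f.surjective.range_comp b
  rw [this, b.dense_span]
end finalPart
end partI

end RT

/-- There exists a bounded operator `T` on a complex separable infinite-dimensional Hilbert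
space `H` such that (P1) for every `x ∈ H` the closure of the orbit of `x` under `T` is a
linear subspace (it coincides with the closure of the linear span of the orbit), (P2) the
family of orbit closures is totally ordered by inclusion, and (P') every closed subspace `M`
invariant under `T` is the orbit closure of one of its vectors. -/
theorem stmt_17 (H : Type) [NormedAddCommGroup H] [InnerProductSpace ℂ H] [CompleteSpace H]
    [TopologicalSpace.SeparableSpace H] (hdim : ¬ FiniteDimensional ℂ H) :
    ∃ T : H →L[ℂ] H,
      (∀ x : H, closure (Set.range fun n : ℕ => (T ^ n) x) =
        closure (Submodule.span ℂ (Set.range fun n : ℕ => (T ^ n) x) : Set H)) ∧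
      (∀ x y : H,
        closure (Set.range fun n : ℕ => (T ^ n) x) ⊆
          closure (Set.range fun n : ℕ => (T ^ n) y) ∨
        closure (Set.range fun n : ℕ => (T ^ n) y) ⊆
          closure (Set.range fun n : ℕ => (T ^ n) x)) ∧
      (∀ M : Submodule ℂ H, IsClosed (M : Set H) → (∀ x ∈ M, T x ∈ M) →
        ∃ x ∈ M, closure (Set.range fun n : ℕ => (T ^ n) x) = M) := by
  obtain ⟨e, he, hd⟩ := RT.exists_basis (H := H) hdim
  obtain ⟨T, hA, hB⟩ := RT.exists_final he hd
  exact ⟨T, RT.abstract_final T hA hB⟩
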